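/- Fix i ≥ 1. If a section-hyperbolic polynomial p(x) = 1 + a_1 x + ... + a_{i+1} x^{i+1} of degree i+1 with constant term 1 satisfies a_i^2/(a_{i−1} a_{i+1}) = A_i^2/(A_{i−1} A_{i+1}), then there exists c > 0 such that p(x) = p_{i+1}(c·x); that is, up to rescaling of the independent variable, p_{i+1} is the unique section-hyperbolic polynomial of degree i+1 minimizing a_i^2/(a_{i−1} a_{i+1}). -/

import Mathlib

open Polynomial

/-- A real polynomial is hyperbolic if all of its complex roots are real. -/
def Hyperbolic (P : Polynomial ℝ) : Prop :=
  ∀ z : ℂ, Polynomial.aeval z P = 0 → z.im = 0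

/-- The `i`-th section `a_0 + a_1 x + ... + a_i x^i` of the coefficient sequence `a`. -/
noncomputable def sect (a : ℕ → ℝ) (i : ℕ) : Polynomial ℝ :=
  ∑ j ∈ Finset.range (i + 1), Polynomial.C (a j) * Polynomial.X ^ j

/-- A polynomial `a_0 + ... + a_n x^n` with all coefficients positive is section-hyperbolic
if each of its sections of degree `1,...,n` is hyperbolic. -/
def SectionHyperbolic (a : ℕ → ℝ) (n : ℕ) : Prop :=
  (∀ i ≤ n, 0 < a i) ∧ ∀ i, 1 ≤ i → i ≤ n → Hyperbolic (sect a i)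

/-- The coefficients of the extremal series: `A_0 = A_1 = 1` and `A_{n+2}` is the largest
(here: supremum of) positive `t` such that `p_{n+1}(x) + t x^{n+2}` is hyperbolic, where
`p_{n+1}(x) = Σ_{j=0}^{n+1} A_j x^j`. -/
noncomputable def Acoef : ℕ → ℝ
  | 0 => 1
  | 1 => 1
  | n + 2 =>
    sSup {t : ℝ | 0 < t ∧ Hyperbolic
      ((∑ j ∈ (Finset.range (n + 2)).attach, Polynomial.C (Acoef j.1) * Polynomial.X ^ (j.1 : ℕ)) +
        Polynomial.C t * Polynomial.X ^ (n + 2))}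
decreasing_by
  exact Finset.mem_range.mp j.2

/-- A refined lower bound for `log (1 + u)` for small `u`. -/
theorem le_log_one_add_refined {u : ℝ} (hu : 0 ≤ u) (hu' : u ≤ 0.3425) :
    u - 0.556 * (u * (u / (1 + u))) ≤ Real.log (1 + u) := by
  have h1 := Real.le_log_one_add_of_nonneg (x := u / 2) (by positivity)
  have h2 := Real.le_log_one_add_of_nonneg (x := u / (2 + u)) (by positivity)
  have h3 : Real.log (1 + u) = Real.log (1 + u / 2) + Real.log (1 + u / (2 + u)) := by
    rw [← Real.log_mul (by positivity) (by positivity)]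
    congr 1; field_simp; ring
  have h4 : u - 0.556 * (u * (u / (1 + u))) ≤
      2 * (u / 2) / (u / 2 + 2) + 2 * (u / (2 + u)) / (u / (2 + u) + 2) := by
    have e : 2 * (u / 2) / (u / 2 + 2) + 2 * (u / (2 + u)) / (u / (2 + u) + 2)
      - (u - 0.556 * (u * (u / (1 + u)))) =
      u ^ 2 * (0.556 * (16 + 16 * u + 3 * u ^ 2) - (1 + u) * (8 + 3 * u)) /
          ((1 + u) * (4 + u) * (4 + 3 * u)) := by
      field_simp
      ring
    have : 0 ≤ u ^ 2 * (0.556 * (16 + 16 * u + 3 * u ^ 2) - (1 + u) * (8 + 3 * u)) /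
          ((1 + u) * (4 + u) * (4 + 3 * u)) := by
      apply div_nonneg _ (by positivity)
      apply mul_nonneg (by positivity)
      nlinarith
    linarith
  linarith

theorem log_one_add_le_sub {u : ℝ} (hu : 0 ≤ u) :
    Real.log (1 + u) ≤ u - 1 / 2 * (u * (u / (1 + u))) := by
  have h := Real.self_le_sinh_iff.2 (Real.log_nonneg (by linarith : (1 : ℝ) ≤ 1 + u))
  rw [Real.sinh_log (by linarith)] at h
  have : ((1 + u) - (1 + u)⁻¹) / 2 = u - 1 / 2 * (u * (u / (1 + u))) := by
    field_simp; ring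
  linarith

theorem one_le_of_contraction {σ : ℝ} (h1 : 1 / 1.3425 ≤ σ) (h2 : σ ≤ 1) :
    1 ≤ 0.315 * Real.exp (0.685 * (1 - 0.556 * (1 - σ))) * (2 - 0.315 * σ) := by
  have h1' : 0.7448 ≤ σ := le_trans (by norm_num) h1
  have e1 : 1.7995 ≤ Real.exp 0.58780 := by
    have := Real.sum_le_exp_of_nonneg (x := 0.58780) (by norm_num) 7
    refine le_trans ?_ this
    norm_num [Finset.sum_range_succ, Nat.factorial]
  have e2 : Real.exp (0.685 * (1 - 0.556 * (1 - σ))) =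
      Real.exp 0.58780 * Real.exp (0.685 * (1 - 0.556 * (1 - σ)) - 0.58780) := by
    rw [← Real.exp_add]; ring_nf
  have e3 := Real.add_one_le_exp (0.685 * (1 - 0.556 * (1 - σ)) - 0.58780)
  have e4 : 1.7995 * (0.685 * (1 - 0.556 * (1 - σ)) - 0.58780 + 1) ≤
      Real.exp (0.685 * (1 - 0.556 * (1 - σ))) := by
    rw [e2]
    apply mul_le_mul e1 e3 _ (by positivity)
    nlinarith
  have e5 : 0 ≤ 2 - 0.315 * σ := by linarith
  have e6 := mul_le_mul_of_nonneg_right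
    (mul_le_mul_of_nonneg_left e4 (by norm_num : (0:ℝ) ≤ 0.315)) e5
  refine le_trans ?_ e6
  nlinarith

theorem crit_test_polynomial_le {D : ℝ} (hD : 0 ≤ D) (hD' : D ≤ 1 / 2) :
    (0.28 + 0.09 * D) * (2 - (0.28 + 0.09 * D) * (1 - D)) *
      (2.0545 * (1 - 0.45 * D + 0.14625 * D ^ 2)) ≤ 1 := by
  have d2 : D ^ 2 ≤ D / 2 := by nlinarith
  have d3 : D ^ 3 ≤ D / 4 := by
    have := mul_le_mul_of_nonneg_left d2 hD
    linear_combination this + 1 / 2 * d2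
  have d4 : D ^ 4 ≤ D / 8 := by
    have := mul_le_mul_of_nonneg_left d3 hD
    linear_combination this + 1 / 4 * d2
  have d5 : D ^ 5 ≤ D / 16 := by
    have := mul_le_mul_of_nonneg_left d4 hD
    linear_combination this + 1 / 8 * d2
  ring_nf
  linarith

theorem crit_test_value_le {D : ℝ} (hD : 0 ≤ D) (hD' : D ≤ 1 / 2) :
    (0.28 + 0.09 * D) * Real.exp ((1 - (0.28 + 0.09 * D)) * (1 - D / 2)) *
      (2 - (0.28 + 0.09 * D) * (1 - D)) ≤ 1 := by
  have e1 : Real.exp 0.72 ≤ 2.0545 := by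
    have := Real.exp_bound' (x := 0.72) (by norm_num) (by norm_num) (n := 8) (by norm_num)
    refine le_trans this ?_
    norm_num [Finset.sum_range_succ, Nat.factorial]
  have e2 : (1 - (0.28 + 0.09 * D)) * (1 - D / 2) = 0.72 + -(0.45 * D - 0.045 * D ^ 2) := by ring
  have e3 : Real.exp (-(0.45 * D - 0.045 * D ^ 2)) ≤ 1 - 0.45 * D + 0.14625 * D ^ 2 := by
    set w := 0.45 * D - 0.045 * D ^ 2 with hw
    have hw0 : 0 ≤ w := by nlinarith
    have := Real.quadratic_le_exp_of_nonneg hw0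
    rw [Real.exp_neg]
    have h2 : (1 + w + w ^ 2 / 2)⁻¹ ≤ 1 - w + w ^ 2 / 2 := by
      rw [inv_le_iff_one_le_mul₀ (by positivity)]
      nlinarith [sq_nonneg (w ^ 2)]
    have h3 : w ^ 2 / 2 ≤ 0.10125 * D ^ 2 := by
      have : w ≤ 0.45 * D := by nlinarith
      nlinarith
    have h4 := le_trans (inv_anti₀ (by positivity) this) h2
    linarith
  have e4 : Real.exp ((1 - (0.28 + 0.09 * D)) * (1 - D / 2)) ≤
      2.0545 * (1 - 0.45 * D + 0.14625 * D ^ 2) := by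
    rw [e2, Real.exp_add]
    exact mul_le_mul e1 e3 (by positivity) (by norm_num)
  have e5 : 0 ≤ (0.28 + 0.09 * D) * (2 - (0.28 + 0.09 * D) * (1 - D)) :=
    mul_nonneg (by positivity) (by nlinarith)
  have e6 := mul_le_mul_of_nonneg_left e4 e5
  have e7 := crit_test_polynomial_le hD hD'
  linarith

theorem crit_lower_bound {y D : ℝ} (hy : 0 < y) (hD : 0 ≤ D) (hD' : D ≤ 1 / 2)
    (h : 1 ≤ y * Real.exp ((1 - y) * (1 - D / 2)) * (2 - y * (1 - D))) :
    0.28 + 0.09 * D ≤ y := by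
  by_contra hlt
  push Not at hlt
  set Y := 0.28 + 0.09 * D with hY
  have hY0 : 0.28 ≤ Y := by linarith
  have hY1 : Y ≤ 0.325 := by linarith
  have a1 : y ≤ Y * Real.exp (-(3 * (Y - y))) := by
    have := Real.add_one_le_exp (-(3 * (Y - y)))
    have h2 := mul_le_mul_of_nonneg_left this (by linarith : (0:ℝ) ≤ Y)
    nlinarith
  have a2 : Real.exp ((1 - y) * (1 - D / 2)) ≤
      Real.exp ((1 - Y) * (1 - D / 2)) * Real.exp (Y - y) := by
    rw [← Real.exp_add]
    apply Real.exp_le_exp.2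
    nlinarith
  have a3 : 2 - y * (1 - D) ≤ (2 - Y * (1 - D)) * Real.exp (Y - y) := by
    have := Real.add_one_le_exp (Y - y)
    have h2 := mul_le_mul_of_nonneg_left this (by nlinarith : (0:ℝ) ≤ 2 - Y * (1 - D))
    have h3 : 0 ≤ (Y - y) * (2 - Y * (1 - D) - (1 - D)) :=
      mul_nonneg (by linarith) (by nlinarith)
    linarith
  have a4 : y * Real.exp ((1 - y) * (1 - D / 2)) * (2 - y * (1 - D)) ≤
      (Y * Real.exp (-(3 * (Y - y)))) * (Real.exp ((1 - Y) * (1 - D / 2)) * Real.exp (Y - y)) *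
        ((2 - Y * (1 - D)) * Real.exp (Y - y)) := by
    apply mul_le_mul (mul_le_mul a1 a2 (by positivity) (by positivity)) a3 _ (by positivity)
    nlinarith
  have a5 : (Y * Real.exp (-(3 * (Y - y)))) * (Real.exp ((1 - Y) * (1 - D / 2)) * Real.exp (Y - y)) *
        ((2 - Y * (1 - D)) * Real.exp (Y - y)) =
      Y * Real.exp ((1 - Y) * (1 - D / 2)) * (2 - Y * (1 - D)) * Real.exp (-(Y - y)) := by
    have : Real.exp (-(Y - y)) =
        Real.exp (-(3 * (Y - y))) * Real.exp (Y - y) * Real.exp (Y - y) := by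
      rw [← Real.exp_add, ← Real.exp_add]; ring_nf
    rw [this]; ring
  have a6 : Real.exp (-(Y - y)) < 1 := by
    rw [Real.exp_lt_one_iff]; linarith
  have a7 := crit_test_value_le hD hD'
  rw [← hY] at a7
  have a8 : 0 ≤ Y * Real.exp ((1 - Y) * (1 - D / 2)) * (2 - Y * (1 - D)) := by
    have e5 : 0 ≤ 2 - Y * (1 - D) := by nlinarith
    positivity
  have : Y * Real.exp ((1 - Y) * (1 - D / 2)) * (2 - Y * (1 - D)) * Real.exp (-(Y - y)) < 1 := by
    have := Real.exp_pos (-(Y - y))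
    nlinarith
  linarith

theorem quarter_bound {y s₁ s₂ : ℝ} (hy : 0.28 + 0.09 * (1 - s₁) ≤ y) (hy1 : y < 1)
    (hs : 1 / 2 ≤ s₁) (hs' : s₁ ≤ 1)
    (h : (1 - 0.315 * y) * (2 - y) * (1 - s₁) ≤ (2 - 0.315 * y) * (1 - y) * (1 - s₂)) :
    4 * (0.315 * s₂ * (1 - y * s₁)) ≤ s₁ * (1 - 0.315 * y * s₂) := by
  have h2 : 1.139 * (1 - s₁) ≤ 1 - s₂ := by
    have k1 : 1.139 * ((2 - 0.315 * y) * (1 - y)) ≤ (1 - 0.315 * y) * (2 - y) := by nlinarith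
    have k2 : 0 < (2 - 0.315 * y) * (1 - y) := by nlinarith
    have k3 := mul_le_mul_of_nonneg_right k1 (sub_nonneg.2 hs')
    by_contra hh
    push Not at hh
    have := mul_lt_mul_of_pos_left hh k2
    nlinarith
  have h3 : s₂ ≤ 1 - 1.139 * (1 - s₁) := by linarith
  have key : s₂ * (1.26 - 0.945 * y * s₁) ≤ s₁ := by
    have k : 0 ≤ 1.26 - 0.945 * y * s₁ := by nlinarith
    have k1 := mul_le_mul_of_nonneg_right h3 k
    have k2 : (1 - 1.139 * (1 - s₁)) * (1.26 - 0.945 * (0.28 + 0.09 * (1 - s₁)) * s₁) ≤ s₁ := by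
      obtain ⟨D, rfl⟩ : ∃ D, s₁ = 1 - D := ⟨1 - s₁, by ring⟩
      have hD : 0 ≤ D := by linarith
      have hD' : D ≤ 1 / 2 := by linarith
      nlinarith [mul_nonneg hD (sub_nonneg.2 hD'), mul_nonneg (mul_nonneg hD hD) (sub_nonneg.2 hD'),
        sq_nonneg (D - 0.15), sq_nonneg (D - 0.2),
        mul_nonneg hD (sq_nonneg (D - 0.2)), mul_nonneg hD (sq_nonneg (D - 0.15))]
    have k3 : 0 ≤ (1 - 1.139 * (1 - s₁)) * s₁ := by
      apply mul_nonneg <;> linarith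
    have k4 := mul_le_mul_of_nonneg_left hy k3
    nlinarith
  nlinarith

/-- The polynomial function `y ↦ ∏ (s - y)` with roots `s ∈ S`. -/
noncomputable def rootProd (S : Multiset ℝ) (y : ℝ) : ℝ := (S.map fun s => s - y).prod

/-- The negated logarithmic derivative of `rootProd S`. -/
noncomputable def rootSum (S : Multiset ℝ) (y : ℝ) : ℝ := (S.map fun s => (s - y)⁻¹).sum

theorem rootProd_pos {S : Multiset ℝ} {y : ℝ} (h : ∀ s ∈ S, y < s) : 0 < rootProd S y := by
  apply Multiset.prod_pos
  intro t ht
  obtain ⟨s, hs, rfl⟩ := Multiset.mem_map.1 ht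
  exact sub_pos.2 (h s hs)

theorem rootProd_eq_zero_iff {S : Multiset ℝ} {y : ℝ} : rootProd S y = 0 ↔ y ∈ S := by
  rw [rootProd, Multiset.prod_eq_zero_iff, Multiset.mem_map]
  constructor
  · rintro ⟨s, hs, h⟩
    rwa [← sub_eq_zero.1 h]
  · intro h
    exact ⟨y, h, sub_self y⟩

theorem rootProd_cons (s : ℝ) (S : Multiset ℝ) (y : ℝ) :
    rootProd (s ::ₘ S) y = (s - y) * rootProd S y := by
  simp [rootProd]

theorem rootSum_cons (s : ℝ) (S : Multiset ℝ) (y : ℝ) :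
    rootSum (s ::ₘ S) y = (s - y)⁻¹ + rootSum S y := by
  simp [rootSum]

theorem hasDerivAt_rootProd {S : Multiset ℝ} {y : ℝ} (h : y ∉ S) :
    HasDerivAt (rootProd S) (-(rootProd S y * rootSum S y)) y := by
  induction S using Multiset.induction with
  | empty =>
    have : rootProd 0 = fun _ => 1 := by ext; simp [rootProd]
    rw [this]
    simpa [rootSum] using hasDerivAt_const y (1 : ℝ)
  | cons s S ih =>
    rw [Multiset.mem_cons, not_or] at h
    have e : rootProd (s ::ₘ S) = fun y => (s - y) * rootProd S y := by
      ext; rw [rootProd_cons]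
    have h1 : HasDerivAt (fun y => (s - y) * rootProd S y) _ y :=
      ((hasDerivAt_id y).const_sub s).mul (ih h.2)
    rw [e, rootSum_cons]
    refine h1.congr_deriv ?_
    have : (s - y) * (s - y)⁻¹ = 1 := mul_inv_cancel₀ (sub_ne_zero.2 (Ne.symm h.1))
    simp only [id]
    linear_combination rootProd S y * this

theorem rootSum_mono {S : Multiset ℝ} {x y : ℝ} (hxy : x ≤ y) (h : ∀ s ∈ S, y < s) :
    rootSum S x ≤ rootSum S y := by
  apply Multiset.sum_map_le_sum_map
  intro s hs
  have := h s hs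
  exact inv_anti₀ (by linarith) (by linarith)

theorem rootSum_nonneg {S : Multiset ℝ} {y : ℝ} (h : ∀ s ∈ S, y < s) : 0 ≤ rootSum S y := by
  apply Multiset.sum_nonneg
  intro t ht
  obtain ⟨s, hs, rfl⟩ := Multiset.mem_map.1 ht
  have := h s hs
  exact inv_nonneg.2 (by linarith)

theorem inv_le_rootSum {S : Multiset ℝ} {y s : ℝ} (h : ∀ s ∈ S, y < s) (hs : s ∈ S) :
    (s - y)⁻¹ ≤ rootSum S y := by
  obtain ⟨T, rfl⟩ := Multiset.exists_cons_of_mem hs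
  rw [rootSum_cons]
  have := rootSum_nonneg (S := T) (y := y) fun s hs => h s (Multiset.mem_cons_of_mem hs)
  linarith

theorem rootSum_pos {S : Multiset ℝ} {y : ℝ} (h : ∀ s ∈ S, y < s) (hS : S ≠ 0) :
    0 < rootSum S y := by
  obtain ⟨s, hs⟩ := Multiset.exists_mem_of_ne_zero hS
  exact lt_of_lt_of_le (inv_pos.2 (sub_pos.2 (h s hs))) (inv_le_rootSum h hs)

theorem mul_rootSum_lt {S : Multiset ℝ} {x y : ℝ} (hx : 0 ≤ x) (hxy : x < y)
    (h : ∀ s ∈ S, y < s) (hS : S ≠ 0) : x * rootSum S x < y * rootSum S y := by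
  have h1 := rootSum_mono hxy.le h
  have h2 := rootSum_pos h hS
  nlinarith

theorem mul_rootSum_le {S : Multiset ℝ} {x y : ℝ} (hx : 0 ≤ x) (hxy : x ≤ y)
    (h : ∀ s ∈ S, y < s) : x * rootSum S x ≤ y * rootSum S y := by
  have h1 := rootSum_mono hxy h
  have h2 := rootSum_nonneg (y := x) fun s hs => lt_of_le_of_lt hxy (h s hs)
  nlinarith

/-- Termwise comparison of a product with an exponential of a sum. -/
theorem prod_mul_exp_sum_le {S : Multiset ℝ} {f g h : ℝ → ℝ} (hg : ∀ s ∈ S, 0 ≤ g s)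
    (H : ∀ s ∈ S, g s * Real.exp (h s) ≤ f s) :
    (S.map g).prod * Real.exp (S.map h).sum ≤ (S.map f).prod := by
  induction S using Multiset.induction with
  | empty => simp
  | cons s S ih =>
    have h1 := ih (fun t ht => hg t (Multiset.mem_cons_of_mem ht))
      (fun t ht => H t (Multiset.mem_cons_of_mem ht))
    have h2 := H s (Multiset.mem_cons_self s S)
    have h3 := hg s (Multiset.mem_cons_self s S)
    simp only [Multiset.map_cons, Multiset.prod_cons, Multiset.sum_cons, Real.exp_add]
    have h4 : 0 ≤ (S.map g).prod := by
      apply Multiset.prod_nonneg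
      intro t ht
      obtain ⟨u, hu, rfl⟩ := Multiset.mem_map.1 ht
      exact hg u (Multiset.mem_cons_of_mem hu)
    calc _ = (g s * Real.exp (h s)) * ((S.map g).prod * Real.exp (S.map h).sum) := by ring
      _ ≤ _ := mul_le_mul h2 h1 (by positivity) (le_trans (by positivity) h2)

theorem prod_le_prod_mul_exp_sum {S : Multiset ℝ} {f g h : ℝ → ℝ} (hf : ∀ s ∈ S, 0 ≤ f s)
    (H : ∀ s ∈ S, f s ≤ g s * Real.exp (h s)) :
    (S.map f).prod ≤ (S.map g).prod * Real.exp (S.map h).sum := by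
  have := prod_mul_exp_sum_le (S := S) (f := g) (g := f) (h := fun s => - h s) hf (by
    intro s hs
    have := H s hs
    rw [Real.exp_neg, ← div_eq_mul_inv, div_le_iff₀ (Real.exp_pos _)]
    exact this)
  rw [Multiset.sum_map_neg, Real.exp_neg, ← div_eq_mul_inv, div_le_iff₀ (Real.exp_pos _)] at this
  exact this

theorem rootProd_le_mul_exp {S : Multiset ℝ} {x y : ℝ} (hx : ∀ s ∈ S, x < s)
    (hy : ∀ s ∈ S, y ≤ s) : rootProd S y ≤ rootProd S x * Real.exp ((x - y) * rootSum S x) := by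
  have := prod_le_prod_mul_exp_sum (S := S) (f := fun s => s - y) (g := fun s => s - x)
    (h := fun s => (x - y) * (s - x)⁻¹) (fun s hs => sub_nonneg.2 (hy s hs)) (by
      intro s hs
      have h1 : 0 < s - x := sub_pos.2 (hx s hs)
      have h2 := Real.add_one_le_exp ((x - y) * (s - x)⁻¹)
      calc s - y = (s - x) * ((x - y) * (s - x)⁻¹ + 1) := by field_simp; ring
        _ ≤ _ := mul_le_mul_of_nonneg_left h2 h1.le)
  rwa [Multiset.sum_map_mul_left] at this

/-- A point where `x * rootSum S x = 1` is the strict maximum of `y * rootProd S y`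
before the first root. -/
theorem mul_rootProd_lt {S : Multiset ℝ} {x y : ℝ} (hx0 : 0 < x) (hx : ∀ s ∈ S, x < s)
    (h1 : x * rootSum S x = 1) (hy0 : 0 ≤ y) (hy : ∀ s ∈ S, y ≤ s) (hne : y ≠ x) :
    y * rootProd S y < x * rootProd S x := by
  have hP := rootProd_pos hx
  have h2 := rootProd_le_mul_exp hx hy
  have h3 : rootSum S x = 1 / x := by field_simp; linarith
  have h4 : (y - x) / x + 1 < Real.exp ((y - x) / x) := by
    apply Real.add_one_lt_exp
    exact div_ne_zero (sub_ne_zero.2 hne) hx0.ne'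
  have h5 : y < x * Real.exp ((y - x) / x) := by
    have := mul_lt_mul_of_pos_left h4 hx0
    have e : x * ((y - x) / x + 1) = y := by field_simp; ring
    linarith
  calc y * rootProd S y ≤ y * (rootProd S x * Real.exp ((x - y) * rootSum S x)) :=
        mul_le_mul_of_nonneg_left h2 hy0
    _ < x * Real.exp ((y - x) / x) * (rootProd S x * Real.exp ((x - y) * rootSum S x)) := by
        gcongr
    _ = x * rootProd S x * (Real.exp ((y - x) / x) * Real.exp ((x - y) * rootSum S x)) := by ring
    _ = x * rootProd S x := by
        rw [← Real.exp_add, h3]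
        have : (y - x) / x + (x - y) * (1 / x) = 0 := by field_simp; ring
        rw [this]; simp

theorem continuous_rootProd (S : Multiset ℝ) : Continuous (rootProd S) := by
  induction S using Multiset.induction with
  | empty =>
    have : rootProd 0 = fun _ => 1 := by ext; simp [rootProd]
    rw [this]; exact continuous_const
  | cons s S ih =>
    have e : rootProd (s ::ₘ S) = fun y => (s - y) * rootProd S y := by
      ext; rw [rootProd_cons]
    rw [e]
    fun_prop

theorem exists_min_mem {S : Multiset ℝ} (hS : S ≠ 0) : ∃ m ∈ S, ∀ s ∈ S, m ≤ s := by
  classical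
  have : S.toFinset.Nonempty := by
    obtain ⟨s, hs⟩ := Multiset.exists_mem_of_ne_zero hS
    exact ⟨s, Multiset.mem_toFinset.2 hs⟩
  obtain ⟨m, hm, h⟩ := S.toFinset.exists_min_image id this
  exact ⟨m, Multiset.mem_toFinset.1 hm, fun s hs => h s (Multiset.mem_toFinset.2 hs)⟩

theorem exists_critical {S : Multiset ℝ} (hS : S ≠ 0) (hpos : ∀ s ∈ S, 0 < s) :
    ∃ x, 0 < x ∧ (∀ s ∈ S, x < s) ∧ x * rootSum S x = 1 := by
  obtain ⟨m, hm, hmin⟩ := exists_min_mem hS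
  have hm0 := hpos m hm
  obtain ⟨x, hx, hmax⟩ := isCompact_Icc.exists_isMaxOn (Set.nonempty_Icc.2 hm0.le)
    (f := fun y => y * rootProd S y) ((continuous_id.mul (continuous_rootProd S)).continuousOn)
  have hhalf : 0 < m / 2 * rootProd S (m / 2) := by
    apply mul_pos (by linarith)
    exact rootProd_pos fun s hs => by linarith [hmin s hs]
  have hval : 0 < x * rootProd S x := lt_of_lt_of_le hhalf
    (hmax (show m / 2 ∈ Set.Icc 0 m from ⟨by linarith, by linarith⟩))
  have hx0 : 0 < x := by
    rcases hx.1.eq_or_lt with h | h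
    · rw [← h] at hval; simp at hval
    · exact h
  have hxm : x < m := by
    rcases hx.2.eq_or_lt with h | h
    · rw [h, rootProd_eq_zero_iff.2 hm] at hval; simp at hval
    · exact h
  have hlt : ∀ s ∈ S, x < s := fun s hs => lt_of_lt_of_le hxm (hmin s hs)
  refine ⟨x, hx0, hlt, ?_⟩
  have hloc : IsLocalMax (fun y => y * rootProd S y) x :=
    hmax.isLocalMax (Icc_mem_nhds hx0 hxm)
  have hd := (hasDerivAt_id x).mul (hasDerivAt_rootProd fun h => lt_irrefl x (hlt x h))
  have h0 := hloc.hasDerivAt_eq_zero hd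
  simp only [id] at h0
  have hP := rootProd_pos hlt
  have : rootProd S x * (1 - x * rootSum S x) = 0 := by linarith
  rcases mul_eq_zero.1 this with h | h
  · exact absurd h hP.ne'
  · linarith

/-- Contraction: the next critical point is at most `0.315` times the current one. -/
theorem contraction_test {S : Multiset ℝ} {x : ℝ} (hx : 0 < x) (h3 : ∀ s ∈ S, 3 * x ≤ s)
    (h1 : x * rootSum S x = 1) :
    rootProd S x ≤ 0.315 * rootProd S (0.315 * x) * (2 - 0.315 * x * rootSum S (0.315 * x)) := by
  set σ := x * rootSum S (0.315 * x) with hσ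
  have hxs : ∀ s ∈ S, x < s := fun s hs => by linarith [h3 s hs]
  have hzs : ∀ s ∈ S, 0.315 * x < s := fun s hs => by linarith [h3 s hs]
  have hP := rootProd_pos hxs
  have hσ1 : σ ≤ 1 := by
    rw [← h1]
    exact mul_le_mul_of_nonneg_left (rootSum_mono (by linarith) hxs) hx.le
  have hσ0 : 1 / 1.3425 ≤ σ := by
    have : 1 / 1.3425 * rootSum S x ≤ rootSum S (0.315 * x) := by
      rw [rootSum, rootSum, ← Multiset.sum_map_mul_left]
      apply Multiset.sum_map_le_sum_map
      intro s hs
      have := h3 s hs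
      rw [← div_eq_mul_inv, ← one_div, div_div, div_le_div_iff₀ (by nlinarith) (by linarith)]
      linarith
    have := mul_le_mul_of_nonneg_left this hx.le
    linarith
  have hprod := prod_mul_exp_sum_le (S := S) (g := fun s => s - x) (f := fun s => s - 0.315 * x)
    (h := fun s => 0.685 * (1 - 0.556) * x * (s - x)⁻¹ + 0.685 * 0.556 * x * (s - 0.315 * x)⁻¹)
    (fun s hs => by linarith [h3 s hs]) (by
      intro s hs
      have hs3 := h3 s hs
      have hd : 0 < s - x := by linarith
      have hd' : 0 < s - 0.315 * x := by linarith
      set u := 0.685 * x / (s - x) with hu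
      have hu0 : 0 ≤ u := by positivity
      have hu1 : u ≤ 0.3425 := by
        rw [hu, div_le_iff₀ hd]; linarith
      have e1 : s - 0.315 * x = (s - x) * (1 + u) := by rw [hu]; field_simp; ring
      have e2 := le_log_one_add_refined hu0 hu1
      have e3 : 0.685 * (1 - 0.556) * x * (s - x)⁻¹ + 0.685 * 0.556 * x * (s - 0.315 * x)⁻¹ =
          u - 0.556 * (u * (u / (1 + u))) := by
        rw [e1]
        have : u = 0.685 * x * (s - x)⁻¹ := by rw [hu, div_eq_mul_inv]
        have h1u : (1 + u) ≠ 0 := by positivity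
        rw [mul_inv]
        calc _ = (1 - 0.556) * u + 0.556 * (u * (1 + u)⁻¹) := by rw [this]; ring
          _ = _ := by field_simp; ring
      have e4 : Real.exp (u - 0.556 * (u * (u / (1 + u)))) ≤ 1 + u := by
        rw [← Real.le_log_iff_exp_le (by positivity)]
        exact e2
      rw [e3, e1]
      exact mul_le_mul_of_nonneg_left e4 hd.le)
  rw [Multiset.sum_map_add, Multiset.sum_map_mul_left, Multiset.sum_map_mul_left] at hprod
  change rootProd S x * Real.exp (0.685 * (1 - 0.556) * x * rootSum S x +
    0.685 * 0.556 * x * rootSum S (0.315 * x)) ≤ rootProd S (0.315 * x) at hprod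
  have e : 0.685 * (1 - 0.556) * x * rootSum S x + 0.685 * 0.556 * x * rootSum S (0.315 * x) =
      0.685 * (1 - 0.556 * (1 - σ)) := by
    rw [hσ]
    linear_combination 0.685 * (1 - 0.556) * h1
  rw [e] at hprod
  have hnum := one_le_of_contraction hσ0 hσ1
  have h2σ : 0 ≤ 0.315 * (2 - 0.315 * σ) := by linarith
  have k1 := mul_le_mul_of_nonneg_right hprod h2σ
  have k2 := mul_le_mul_of_nonneg_left hnum hP.le
  have e5 : 0.315 * x * rootSum S (0.315 * x) = 0.315 * σ := by rw [hσ]; ring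
  rw [e5]
  linarith

/-- Superlinear growth of `y L / (1 - y L)` between consecutive critical points. -/
theorem quarter_growth {S : Multiset ℝ} {X x : ℝ} (hX : ∀ s ∈ S, X < s)
    (h1 : X * rootSum S X = 1) (hx : 0 < x) (hxX : x < X)
    (hcrit : X * rootProd S X = x * rootProd S x * (2 - x * rootSum S x)) :
    4 * (0.315 * x * rootSum S (0.315 * x) * (1 - x * rootSum S x)) ≤
      x * rootSum S x * (1 - 0.315 * x * rootSum S (0.315 * x)) := by
  have hX0 : 0 < X := by linarith
  obtain ⟨y, rfl⟩ : ∃ y, x = y * X := ⟨x / X, by field_simp⟩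
  have hy0 : 0 < y := pos_of_mul_pos_left hx hX0.le
  have hy1 : y < 1 := by nlinarith
  have hP := rootProd_pos hX
  have hm : ∀ s ∈ S, X ≤ s - X := by
    intro s hs
    have := inv_le_rootSum hX hs
    have hs' := hX s hs
    have h2 := mul_le_mul_of_nonneg_left this hX0.le
    rw [h1, ← div_eq_mul_inv, div_le_one (by linarith)] at h2
    exact h2
  set s₁ := X * rootSum S (y * X) with hs₁
  set s₂ := X * rootSum S (0.315 * (y * X)) with hs₂
  have hyX : ∀ s ∈ S, y * X < s := fun s hs => by linarith [hX s hs]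
  have hs₁le : s₁ ≤ 1 := by
    rw [← h1]
    exact mul_le_mul_of_nonneg_left (rootSum_mono hxX.le hX) hX0.le
  have hs₁ge : 1 / 2 ≤ s₁ := by
    have : 1 / 2 * rootSum S X ≤ rootSum S (y * X) := by
      rw [rootSum, rootSum, ← Multiset.sum_map_mul_left]
      apply Multiset.sum_map_le_sum_map
      intro s hs
      have := hm s hs
      have := hX s hs
      rw [← div_eq_mul_inv, div_div, ← one_div, div_le_div_iff₀ (by linarith) (by nlinarith)]
      nlinarith
    have := mul_le_mul_of_nonneg_left this hX0.le
    linarith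
  have hprod := prod_le_prod_mul_exp_sum (S := S) (f := fun s => s - y * X) (g := fun s => s - X)
    (h := fun s => (1 - y) / 2 * X * (s - X)⁻¹ + (1 - y) / 2 * X * (s - y * X)⁻¹)
    (fun s hs => by linarith [hyX s hs]) (by
      intro s hs
      have hd : 0 < s - X := by linarith [hX s hs]
      have hd' : 0 < s - y * X := by linarith [hyX s hs]
      set u := (1 - y) * X / (s - X) with hu
      have hu0 : 0 ≤ u := div_nonneg (mul_nonneg (by linarith) hX0.le) hd.le
      have e1 : s - y * X = (s - X) * (1 + u) := by rw [hu]; field_simp; ring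
      have e2 := log_one_add_le_sub hu0
      have e3 : (1 - y) / 2 * X * (s - X)⁻¹ + (1 - y) / 2 * X * (s - y * X)⁻¹ =
          u - 1 / 2 * (u * (u / (1 + u))) := by
        rw [e1]
        have : u = (1 - y) * X * (s - X)⁻¹ := by rw [hu, div_eq_mul_inv]
        have h1u : (1 + u) ≠ 0 := by positivity
        rw [mul_inv]
        calc _ = 1 / 2 * u + 1 / 2 * (u * (1 + u)⁻¹) := by rw [this]; ring
          _ = _ := by field_simp; ring
      have e4 : 1 + u ≤ Real.exp (u - 1 / 2 * (u * (u / (1 + u)))) := by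
        rw [← Real.log_le_iff_le_exp (by positivity)]
        exact e2
      rw [e3, e1]
      exact mul_le_mul_of_nonneg_left e4 hd.le)
  rw [Multiset.sum_map_add, Multiset.sum_map_mul_left, Multiset.sum_map_mul_left] at hprod
  change rootProd S (y * X) ≤ rootProd S X * Real.exp ((1 - y) / 2 * X * rootSum S X +
    (1 - y) / 2 * X * rootSum S (y * X)) at hprod
  have e : (1 - y) / 2 * X * rootSum S X + (1 - y) / 2 * X * rootSum S (y * X) =
      (1 - y) * (1 - (1 - s₁) / 2) := by
    rw [hs₁]
    linear_combination (1 - y) / 2 * h1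
  rw [e] at hprod
  have hlow : 0.28 + 0.09 * (1 - s₁) ≤ y := by
    apply crit_lower_bound hy0 (by linarith) (by linarith)
    have e1 : y * X * rootSum S (y * X) = y * s₁ := by rw [hs₁]; ring
    rw [e1] at hcrit
    have h2 : 0 ≤ y * (2 - y * s₁) := mul_nonneg hy0.le (by nlinarith)
    have h3 := mul_le_mul_of_nonneg_right hprod h2
    have h4 : rootProd S X = rootProd S (y * X) * (y * (2 - y * s₁)) := by
      apply mul_left_cancel₀ hX0.ne'
      linarith
    rw [← h4] at h3
    have h5 : rootProd S X * 1 ≤ rootProd S X *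
        (y * Real.exp ((1 - y) * (1 - (1 - s₁) / 2)) * (2 - y * (1 - (1 - s₁)))) := by
      rw [sub_sub_cancel]
      linarith
    exact le_of_mul_le_mul_left h5 hP
  have hlam : (1 - 0.315 * y) * (2 - y) * (1 - s₁) ≤ (2 - 0.315 * y) * (1 - y) * (1 - s₂) := by
    have e1 : ∀ w, 1 - X * rootSum S w =
        (S.map fun s => X * (s - X)⁻¹ - X * (s - w)⁻¹).sum := by
      intro w
      rw [Multiset.sum_map_sub, Multiset.sum_map_mul_left, Multiset.sum_map_mul_left]
      change _ = X * rootSum S X - X * rootSum S w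
      rw [h1]
    rw [hs₁, hs₂, e1, e1, ← Multiset.sum_map_mul_left, ← Multiset.sum_map_mul_left]
    apply Multiset.sum_map_le_sum_map
    intro s hs
    have hd : 0 < s - X := by linarith [hX s hs]
    have hd' : 0 < s - y * X := by linarith [hyX s hs]
    have hd'' : 0 < s - 0.315 * (y * X) := by linarith [hyX s hs]
    have hms := hm s hs
    have f1 : X * (s - X)⁻¹ - X * (s - y * X)⁻¹ =
        X ^ 2 * (1 - y) / ((s - X) * (s - y * X)) := by
      rw [← mul_sub, inv_sub_inv hd.ne' hd'.ne', mul_div_assoc']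
      ring_nf
    have f2 : X * (s - X)⁻¹ - X * (s - 0.315 * (y * X))⁻¹ =
        X ^ 2 * (1 - 0.315 * y) / ((s - X) * (s - 0.315 * (y * X))) := by
      rw [← mul_sub, inv_sub_inv hd.ne' hd''.ne', mul_div_assoc']
      ring_nf
    rw [f1, f2]
    have f3 : (2 - y) * (s - 0.315 * (y * X)) ≤ (2 - 0.315 * y) * (s - y * X) := by
      nlinarith
    have f4 : (2 - y) / (s - y * X) ≤ (2 - 0.315 * y) / (s - 0.315 * (y * X)) := by
      rw [div_le_div_iff₀ hd' hd'']; exact f3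
    have f5 : 0 ≤ X ^ 2 * (1 - y) * (1 - 0.315 * y) / (s - X) := by
      apply div_nonneg _ hd.le
      exact mul_nonneg (mul_nonneg (by positivity) (by linarith)) (by linarith)
    have f6 := mul_le_mul_of_nonneg_left f4 f5
    calc _ = X ^ 2 * (1 - y) * (1 - 0.315 * y) / (s - X) * ((2 - y) / (s - y * X)) := by
          field_simp
      _ ≤ _ := f6
      _ = _ := by field_simp
  have := quarter_bound hlow hy1 hs₁ge hs₁le hlam
  have e1 : y * X * rootSum S (y * X) = y * s₁ := by rw [hs₁]; ring
  have e2 : 0.315 * (y * X) * rootSum S (0.315 * (y * X)) = 0.315 * y * s₂ := by rw [hs₂]; ring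
  rw [e1, e2]
  have := mul_le_mul_of_nonneg_left this hy0.le
  linarith

/-- The reversed section `∑_{i ≤ k} a_i (-y)^{k-i}`. -/
noncomputable def rev (a : ℕ → ℝ) : ℕ → ℝ → ℝ
  | 0, _ => a 0
  | k + 1, y => a (k + 1) - y * rev a k y

/-- The negated derivative of `rev a k`. -/
noncomputable def revSlope (a : ℕ → ℝ) : ℕ → ℝ → ℝ
  | 0, _ => 0
  | k + 1, y => rev a k y - y * revSlope a k y

/-- The reversed section has only positive real roots. -/
def RealRooted (a : ℕ → ℝ) (k : ℕ) : Prop :=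
  ∃ S : Multiset ℝ, S.card = k ∧ (∀ s ∈ S, 0 < s) ∧ ∀ y, rev a k y = rootProd S y

theorem rev_congr {a b : ℕ → ℝ} {k : ℕ} (h : ∀ i ≤ k, a i = b i) : rev a k = rev b k := by
  induction k with
  | zero => ext y; simp [rev, h 0 le_rfl]
  | succ k ih =>
    ext y
    simp only [rev]
    rw [h (k + 1) le_rfl, ih fun i hi => h i (by omega)]

theorem hasDerivAt_rev (a : ℕ → ℝ) (k : ℕ) (y : ℝ) :
    HasDerivAt (rev a k) (-revSlope a k y) y := by
  induction k with
  | zero =>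
    have : rev a 0 = fun _ => a 0 := by ext; rfl
    rw [this]
    simpa [revSlope] using hasDerivAt_const y (a 0)
  | succ k ih =>
    have : HasDerivAt (fun y => a (k + 1) - y * rev a k y) _ y :=
      ((hasDerivAt_id y).mul ih).const_sub (a (k + 1))
    have e : rev a (k + 1) = fun y => a (k + 1) - y * rev a k y := by ext; rfl
    rw [e]
    refine this.congr_deriv ?_
    simp only [revSlope, id]
    ring

theorem continuous_rev (a : ℕ → ℝ) (k : ℕ) : Continuous (rev a k) :=
  continuous_iff_continuousAt.2 fun y => (hasDerivAt_rev a k y).continuousAt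

theorem rev_zero_right (a : ℕ → ℝ) (k : ℕ) : rev a k 0 = a k := by
  cases k <;> simp [rev]

theorem rev_pos_of_nonpos {a : ℕ → ℝ} {k : ℕ} (h : ∀ i ≤ k, 0 < a i) {y : ℝ} (hy : y ≤ 0) :
    0 < rev a k y := by
  induction k with
  | zero => exact h 0 le_rfl
  | succ k ih =>
    have h1 := ih fun i hi => h i (by omega)
    have h2 := h (k + 1) le_rfl
    simp only [rev]
    nlinarith

theorem eval_sect_succ (a : ℕ → ℝ) (k : ℕ) (x : ℝ) :
    (sect a (k + 1)).eval x = (sect a k).eval x + a (k + 1) * x ^ (k + 1) := by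
  simp [sect, Finset.sum_range_succ _ (k + 1)]

theorem eval_sect_eq (a : ℕ → ℝ) (k : ℕ) {x : ℝ} (hx : x ≠ 0) :
    (sect a k).eval x = x ^ k * rev a k (-x⁻¹) := by
  induction k with
  | zero => simp [sect, rev]
  | succ k ih =>
    rw [eval_sect_succ, ih]
    simp only [rev]
    field_simp
    ring

theorem eval_sect_zero (a : ℕ → ℝ) (k : ℕ) : (sect a k).eval 0 = a 0 := by
  induction k with
  | zero => simp [sect]
  | succ k ih => rw [eval_sect_succ, ih]; simp

theorem coeff_sect (a : ℕ → ℝ) (k i : ℕ) : (sect a k).coeff i = if i ≤ k then a i else 0 := by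
  simp only [sect, finsetSum_coeff, coeff_C_mul, coeff_X_pow]
  simp

theorem natDegree_sect {a : ℕ → ℝ} {k : ℕ} (h : a k ≠ 0) : (sect a k).natDegree = k := by
  apply le_antisymm
  · rw [natDegree_le_iff_coeff_eq_zero]
    intro i hi
    rw [coeff_sect, if_neg (by omega)]
  · apply le_natDegree_of_ne_zero
    rw [coeff_sect, if_pos le_rfl]
    exact h

theorem eval_sect_pos {a : ℕ → ℝ} {k : ℕ} (h : ∀ i ≤ k, 0 < a i) {x : ℝ} (hx : 0 ≤ x) :
    0 < (sect a k).eval x := by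
  induction k with
  | zero => simpa [sect] using h 0 le_rfl
  | succ k ih =>
    rw [eval_sect_succ]
    have h1 := ih fun i hi => h i (by omega)
    have h2 := (h (k + 1) le_rfl).le
    positivity

theorem Hyperbolic.eq_prod {P : ℝ[X]} (h : Hyperbolic P) :
    ∃ R : Multiset ℝ, R.card = P.natDegree ∧
      P = C P.leadingCoeff * (R.map fun r => X - C r).prod := by
  rcases eq_or_ne P 0 with rfl | hP
  · exact ⟨0, by simp⟩
  set Q := P.map (algebraMap ℝ ℂ) with hQ
  have hQ0 : Q ≠ 0 := (Polynomial.map_ne_zero_iff (algebraMap ℝ ℂ).injective).2 hP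
  have hs : Q.Splits := IsAlgClosed.splits Q
  have hcard : Q.roots.card = Q.natDegree := hs.natDegree_eq_card_roots.symm
  refine ⟨Q.roots.map Complex.re, ?_, ?_⟩
  · rw [Multiset.card_map, hcard, hQ, natDegree_map]
  · apply Polynomial.map_injective _ (algebraMap ℝ ℂ).injective
    have e := C_leadingCoeff_mul_prod_multiset_X_sub_C hcard
    rw [← hQ]
    refine e.symm.trans ?_
    rw [Polynomial.map_mul, map_C, Polynomial.map_multiset_prod, Multiset.map_map,
      Multiset.map_map]
    congr 1
    · rw [hQ, leadingCoeff_map]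
    · congr 1
      apply Multiset.map_congr rfl
      intro z hz
      have hz0 : aeval z P = 0 := by
        have := (mem_roots hQ0).1 hz
        rw [IsRoot, hQ, eval_map_algebraMap] at this
        exact this
      have him := h z hz0
      have : ((z.re : ℝ) : ℂ) = z := Complex.ext (by simp) (by simp [him])
      simp [this]

theorem RealRooted.of_hyperbolic {a : ℕ → ℝ} {k : ℕ} (h0 : a 0 = 1) (hpos : ∀ i ≤ k, 0 < a i)
    (h : Hyperbolic (sect a k)) : RealRooted a k := by
  obtain ⟨R, hcard, hR⟩ := h.eq_prod
  have hk := hpos k le_rfl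
  rw [natDegree_sect hk.ne'] at hcard
  have hlc : (sect a k).leadingCoeff = a k := by
    rw [leadingCoeff, natDegree_sect hk.ne', coeff_sect, if_pos le_rfl]
  rw [hlc] at hR
  have hev : ∀ x, (sect a k).eval x = a k * (R.map fun r => x - r).prod := by
    intro x
    rw [hR, eval_mul, eval_C, eval_multiset_prod, Multiset.map_map]
    simp
  have hneg : ∀ r ∈ R, r < 0 := by
    intro r hr
    by_contra hr0
    push Not at hr0
    have h1 := eval_sect_pos hpos hr0
    rw [hev, Multiset.prod_eq_zero (Multiset.mem_map.2 ⟨r, hr, sub_self r⟩)] at h1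
    simp at h1
  have hrev : ∀ y, rev a k y = a k * (R.map fun r => 1 + r * y).prod := by
    intro y
    rcases eq_or_ne y 0 with rfl | hy
    · simp [rev_zero_right]
    · have h1 := eval_sect_eq a k (x := -y⁻¹) (by simpa using hy)
      rw [hev] at h1
      have e : -(-y⁻¹)⁻¹ = y := by simp
      rw [e] at h1
      have h2 : (R.map fun r => 1 + r * y).prod = (-y) ^ k * (R.map fun r => -y⁻¹ - r).prod := by
        rw [← hcard, ← Multiset.prod_replicate, ← Multiset.map_const', ← Multiset.prod_map_mul]
        congr 1
        apply Multiset.map_congr rfl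
        intro r _
        field_simp
        ring
      rw [h2]
      have h3 : (-y) ^ k * (-y⁻¹) ^ k = 1 := by
        rw [← mul_pow]
        have : -y * -y⁻¹ = 1 := by field_simp
        rw [this, one_pow]
      linear_combination (-(rev a k y)) * h3 - (-y) ^ k * h1
  refine ⟨R.map fun r => -r⁻¹, by simpa using hcard, ?_, ?_⟩
  · intro s hs
    obtain ⟨r, hr, rfl⟩ := Multiset.mem_map.1 hs
    have := inv_lt_zero.2 (hneg r hr)
    linarith
  · intro y
    have h1 := hev 0
    rw [eval_sect_zero, h0] at h1
    rw [hrev, rootProd, Multiset.map_map]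
    have h2 : (R.map fun r => 1 + r * y).prod =
        (R.map fun r => 0 - r).prod * (R.map ((fun s => s - y) ∘ fun r => -r⁻¹)).prod := by
      rw [← Multiset.prod_map_mul]
      congr 1
      apply Multiset.map_congr rfl
      intro r hr
      have := (hneg r hr).ne
      simp only [Function.comp]
      field_simp
      ring
    rw [h2, ← mul_assoc, ← h1, one_mul]

theorem RealRooted.hyperbolic {a : ℕ → ℝ} {k : ℕ} (h0 : a 0 = 1) (h : RealRooted a k) :
    Hyperbolic (sect a k) := by
  obtain ⟨S, hcard, hS, hrev⟩ := h
  have hP : sect a k = (S.map fun s => C s * X + 1).prod := by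
    apply Polynomial.funext
    intro x
    rw [eval_multiset_prod, Multiset.map_map]
    rcases eq_or_ne x 0 with rfl | hx
    · simp [eval_sect_zero, h0]
    · rw [eval_sect_eq a k hx, hrev, rootProd, ← hcard, ← Multiset.prod_replicate,
        ← Multiset.map_const', ← Multiset.prod_map_mul]
      congr 1
      apply Multiset.map_congr rfl
      intro s _
      simp
      field_simp
  intro z hz
  rw [hP, map_multiset_prod, Multiset.prod_eq_zero_iff, Multiset.map_map, Multiset.mem_map] at hz
  obtain ⟨s, hs, hz⟩ := hz
  have hs0 := hS s hs
  have : (s : ℂ) * z + 1 = 0 := by simpa using hz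
  have him := congrArg Complex.im this
  simp at him
  exact him.resolve_left hs0.ne'

/-- `S` is the multiset of roots of `rev a k`, all of them positive. -/
structure IsRootSet (a : ℕ → ℝ) (k : ℕ) (S : Multiset ℝ) : Prop where
  card_eq : S.card = k
  pos : ∀ s ∈ S, 0 < s
  rev_eq : ∀ y, rev a k y = rootProd S y

/-- `x` is the critical point of `y * rev a k y` below all roots of `rev a k`. -/
structure IsCrit (S : Multiset ℝ) (x : ℝ) : Prop where
  pos : 0 < x
  lt : ∀ s ∈ S, x < s
  mul_rootSum : x * rootSum S x = 1

/-- The coefficients `a_0 = 1, a_1, …, a_k` are positive and all sections up to order `k` are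
real-rooted. -/
structure Valid (a : ℕ → ℝ) (k : ℕ) : Prop where
  zero : a 0 = 1
  pos : ∀ i ≤ k, 0 < a i
  real : ∀ i ≤ k, RealRooted a i

theorem RealRooted.exists_isRootSet {a : ℕ → ℝ} {k : ℕ} (h : RealRooted a k) :
    ∃ S, IsRootSet a k S := by
  obtain ⟨S, h1, h2, h3⟩ := h
  exact ⟨S, h1, h2, h3⟩

theorem Valid.mono {a : ℕ → ℝ} {k l : ℕ} (h : Valid a k) (hl : l ≤ k) : Valid a l :=
  ⟨h.zero, fun i hi => h.pos i (hi.trans hl), fun i hi => h.real i (hi.trans hl)⟩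

theorem Valid.exists_isRootSet {a : ℕ → ℝ} {k i : ℕ} (h : Valid a k) (hi : i ≤ k) :
    ∃ S, IsRootSet a i S :=
  (h.real i hi).exists_isRootSet

namespace IsRootSet

variable {a : ℕ → ℝ} {k : ℕ} {S T : Multiset ℝ} {x y z : ℝ}

theorem ne_zero (h : IsRootSet a (k + 1) S) : S ≠ 0 := by
  rintro rfl
  simpa using h.card_eq

theorem mem_iff (h : IsRootSet a k S) : y ∈ S ↔ rev a k y = 0 := by
  rw [h.rev_eq, rootProd_eq_zero_iff]

theorem revSlope_eq (h : IsRootSet a k S) (hy : y ∉ S) :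
    revSlope a k y = rootProd S y * rootSum S y := by
  have e : rev a k = rootProd S := funext h.rev_eq
  have h1 := hasDerivAt_rev a k y
  rw [e] at h1
  have := h1.unique (hasDerivAt_rootProd hy)
  linarith

theorem exists_isCrit (h : IsRootSet a (k + 1) S) : ∃ x, IsCrit S x := by
  obtain ⟨x, h1, h2, h3⟩ := exists_critical h.ne_zero h.pos
  exact ⟨x, h1, h2, h3⟩

theorem rootSum_zero (h : IsRootSet a (k + 1) S) : a k = a (k + 1) * rootSum S 0 := by
  have h1 := h.revSlope_eq (y := 0) fun h0 => (h.pos 0 h0).false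
  rw [← h.rev_eq] at h1
  simpa [revSlope, rev_zero_right] using h1

theorem coeff_le_mul (h : IsRootSet a (k + 1) S) (hk : 0 < a (k + 1)) (hy : y ∈ S) :
    a (k + 1) ≤ y * a k := by
  have h1 := inv_le_rootSum h.pos hy
  have hy0 := h.pos y hy
  rw [h.rootSum_zero]
  rw [sub_zero, inv_le_iff_one_le_mul₀ hy0] at h1
  nlinarith

theorem crit_mul_le (h : IsRootSet a (k + 1) S) (hk : 0 < a (k + 1)) (hx : IsCrit S x) :
    x * a k ≤ a (k + 1) := by
  have h1 := rootSum_mono hx.pos.le hx.lt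
  have h2 := hx.mul_rootSum
  have h3 := hx.pos
  rw [h.rootSum_zero]
  have : x * rootSum S 0 ≤ 1 := by nlinarith
  nlinarith

theorem rev_lt_coeff (h : IsRootSet a (k + 1) S) (hy0 : 0 < y) (hy : ∀ s ∈ S, y ≤ s) :
    rev a (k + 1) y < a (k + 1) := by
  have h1 := rootProd_le_mul_exp h.pos hy
  rw [← h.rev_eq, ← h.rev_eq, rev_zero_right] at h1
  have h2 := rootSum_pos h.pos h.ne_zero
  have h3 : Real.exp ((0 - y) * rootSum S 0) < 1 := by
    rw [Real.exp_lt_one_iff]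
    nlinarith
  have h4 : 0 < a (k + 1) := by
    rw [← rev_zero_right a (k + 1), h.rev_eq]
    exact rootProd_pos h.pos
  nlinarith

/-- A lower bound for the roots of the next reversed section is below all roots of the present
one. -/
theorem lt_of_forall_le (h : IsRootSet a k S) (hT : IsRootSet a (k + 1) T)
    (hmin : ∀ t ∈ T, x ≤ t) : ∀ s ∈ S, x < s := by
  intro s hs
  by_contra hsx
  push Not at hsx
  have h1 := hT.rev_lt_coeff (h.pos s hs) fun t ht => hsx.trans (hmin t ht)
  simp [rev, h.mem_iff.1 hs] at h1

theorem mul_rev_lt (h : IsRootSet a k S) (hx : IsCrit S x) (hy0 : 0 ≤ y) (hy : ∀ s ∈ S, y ≤ s)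
    (hne : y ≠ x) : y * rev a k y < x * rev a k x := by
  rw [h.rev_eq, h.rev_eq]
  exact mul_rootProd_lt hx.pos hx.lt hx.mul_rootSum hy0 hy hne

theorem mul_rev_le (h : IsRootSet a k S) (hx : IsCrit S x) (hy0 : 0 ≤ y) (hy : ∀ s ∈ S, y ≤ s) :
    y * rev a k y ≤ x * rev a k x := by
  rcases eq_or_ne y x with rfl | hne
  · rfl
  · exact (h.mul_rev_lt hx hy0 hy hne).le

theorem coeff_le_crit (h : IsRootSet a k S) (hT : IsRootSet a (k + 1) T) (hx : IsCrit S x) :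
    a (k + 1) ≤ x * rev a k x := by
  obtain ⟨t, ht, hmin⟩ := exists_min_mem hT.ne_zero
  have h1 := hT.mem_iff.1 ht
  simp only [rev] at h1
  have h2 := h.mul_rev_le hx (hT.pos t ht).le fun s hs => (h.lt_of_forall_le hT hmin s hs).le
  linarith

end IsRootSet

/-- The polynomial whose evaluation is `rev a k`. -/
noncomputable def revPoly (a : ℕ → ℝ) : ℕ → ℝ[X]
  | 0 => C (a 0)
  | k + 1 => C (a (k + 1)) - X * revPoly a k

theorem eval_revPoly (a : ℕ → ℝ) (k : ℕ) (y : ℝ) : (revPoly a k).eval y = rev a k y := by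
  induction k with
  | zero => simp [revPoly, rev]
  | succ k ih => simp [revPoly, rev, ih]

theorem eval_derivative_revPoly (a : ℕ → ℝ) (k : ℕ) (y : ℝ) :
    (derivative (revPoly a k)).eval y = -revSlope a k y := by
  induction k with
  | zero => simp [revPoly, revSlope]
  | succ k ih => simp [revPoly, revSlope, ih, eval_revPoly]; ring

theorem natDegree_revPoly_le (a : ℕ → ℝ) (k : ℕ) : (revPoly a k).natDegree ≤ k := by
  induction k with
  | zero => simp [revPoly]
  | succ k ih =>
    refine (natDegree_sub_le _ _).trans (max_le (by simp) ?_)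
    refine natDegree_mul_le.trans ?_
    simp only [natDegree_X]
    omega

theorem coeff_revPoly_self (a : ℕ → ℝ) (k : ℕ) : (revPoly a k).coeff k = (-1) ^ k * a 0 := by
  induction k with
  | zero => simp [revPoly]
  | succ k ih => simp [revPoly, ih, pow_succ]

theorem natDegree_revPoly {a : ℕ → ℝ} (h0 : a 0 = 1) (k : ℕ) : (revPoly a k).natDegree = k := by
  refine le_antisymm (natDegree_revPoly_le a k) (le_natDegree_of_ne_zero ?_)
  rw [coeff_revPoly_self, h0]
  simp

theorem rev_eq_rootProd_of_card {a : ℕ → ℝ} {k : ℕ} (h0 : a 0 = 1)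
    (h : (revPoly a k).roots.card = k) (y : ℝ) : rev a k y = rootProd (revPoly a k).roots y := by
  have h1 : (revPoly a k).roots.card = (revPoly a k).natDegree := by
    rw [h, natDegree_revPoly h0]
  have h2 := C_leadingCoeff_mul_prod_multiset_X_sub_C h1
  rw [leadingCoeff, natDegree_revPoly h0, coeff_revPoly_self, h0, mul_one] at h2
  have h3 := congrArg (eval y) h2
  rw [eval_mul, eval_C, eval_multiset_prod, Multiset.map_map, eval_revPoly] at h3
  rw [← h3, rootProd]
  nth_rewrite 1 [← h]
  rw [← Multiset.prod_replicate, ← Multiset.map_const', ← Multiset.prod_map_mul]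
  congr 1
  apply Multiset.map_congr rfl
  intro r _
  simp

theorem revPoly_ne_zero {a : ℕ → ℝ} (h0 : a 0 = 1) (k : ℕ) : revPoly a k ≠ 0 := by
  intro h
  have := coeff_revPoly_self a k
  rw [h, h0] at this
  simp at this
  exact absurd this.symm (pow_ne_zero _ (by norm_num))

theorem RealRooted.of_card_roots {a : ℕ → ℝ} {k : ℕ} (h0 : a 0 = 1) (hpos : ∀ i ≤ k, 0 < a i)
    (h : (revPoly a k).roots.card = k) : RealRooted a k := by
  refine ⟨(revPoly a k).roots, h, ?_, rev_eq_rootProd_of_card h0 h⟩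
  intro s hs
  by_contra hs0
  push Not at hs0
  have h1 := rev_pos_of_nonpos hpos hs0
  rw [mem_roots (revPoly_ne_zero h0 k), IsRoot, eval_revPoly] at hs
  linarith

/-- Two roots of a polynomial `(X - r) * (X - s) * Q` together with sufficiently many further
distinct roots exhaust the degree. -/
theorem card_roots_of_factor {P Q : ℝ[X]} {n : ℕ} {r s : ℝ} (hP : P ≠ 0)
    (hdeg : P.natDegree ≤ n + 2)
    (hf : P = (X - C r) * ((X - C s) * Q)) (ρ : ℕ → ℝ) (hρ : Set.InjOn ρ (Finset.range n))
    (hroot : ∀ i < n, P.eval (ρ i) = 0) (hr : ∀ i < n, ρ i ≠ r) (hs : ∀ i < n, ρ i ≠ s) :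
    P.roots.card = n + 2 := by
  have hQ : Q ≠ 0 := by
    rintro rfl
    exact hP (by simpa using hf)
  have hsQ : (X - C s) * Q ≠ 0 := mul_ne_zero (X_sub_C_ne_zero s) hQ
  apply le_antisymm ((card_roots' P).trans hdeg)
  have h1 : P.roots = {r} + ({s} + Q.roots) := by
    rw [hf, roots_mul (mul_ne_zero (X_sub_C_ne_zero r) hsQ), roots_mul hsQ, roots_X_sub_C,
      roots_X_sub_C]
  have h2 : ((Finset.range n).image ρ).val ≤ Q.roots := by
    rw [Multiset.le_iff_subset (Finset.nodup _)]
    intro x hx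
    rw [Finset.mem_val] at hx
    obtain ⟨i, hi, rfl⟩ := Finset.mem_image.1 hx
    rw [Finset.mem_range] at hi
    rw [mem_roots hQ, IsRoot]
    have h3 := hroot i hi
    rw [hf] at h3
    simpa [sub_eq_zero, hr i hi, hs i hi] using h3
  have h3 := Multiset.card_le_card h2
  rw [Finset.card_val, Finset.card_image_of_injOn hρ, Finset.card_range] at h3
  rw [h1]
  simp
  omega

theorem exists_factor_of_double_root {P : ℝ[X]} {r : ℝ} (h : P.eval r = 0)
    (h' : (derivative P).eval r = 0) : ∃ Q, P = (X - C r) * ((X - C r) * Q) := by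
  obtain ⟨Q, rfl⟩ := dvd_iff_isRoot.2 h
  have : Q.eval r = 0 := by simpa using h'
  obtain ⟨R, rfl⟩ := dvd_iff_isRoot.2 this
  exact ⟨R, rfl⟩

theorem exists_factor_of_ne {P : ℝ[X]} {r s : ℝ} (hr : P.eval r = 0) (hs : P.eval s = 0)
    (hne : r ≠ s) : ∃ Q, P = (X - C r) * ((X - C s) * Q) := by
  obtain ⟨Q, rfl⟩ := dvd_iff_isRoot.2 hr
  have : Q.eval s = 0 := by
    have : s - r ≠ 0 := sub_ne_zero.2 hne.symm
    simpa [this] using hs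
  obtain ⟨R, rfl⟩ := dvd_iff_isRoot.2 this
  exact ⟨R, rfl⟩

/-- Signs of the later reversed sections at a root of an earlier one. -/
theorem rev_sign_alternates {a : ℕ → ℝ} {m : ℕ} {t : ℝ} (ht0 : 0 < t) (ht : rev a m t = 0) (i : ℕ)
    (hpos : ∀ j ≤ m + 1 + i, 0 < a j)
    (hlt : ∀ q, m + 1 ≤ q → q < m + 1 + i → a (q + 1) < t * a q) :
    (Even i → a (m + 1 + i) ≤ rev a (m + 1 + i) t) ∧ (Odd i → rev a (m + 1 + i) t < 0) := by
  induction i with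
  | zero => simp [rev, ht]
  | succ i ih =>
    have ih := ih (fun j hj => hpos j (by omega)) fun q h1 h2 => hlt q h1 (by omega)
    have e : m + 1 + (i + 1) = (m + 1 + i) + 1 := by omega
    rw [e]
    simp only [rev]
    constructor
    · intro he
      have ho : Odd i := by
        rcases Nat.even_or_odd i with h | h
        · exact absurd he (by simpa using h.add_one)
        · exact h
      have := ih.2 ho
      nlinarith
    · intro ho
      have he : Even i := by
        rcases Nat.even_or_odd i with h | h
        · exact h
        · exact absurd ho (by simpa using h.add_one)
      have h1 := ih.1 he
      have h2 := hlt (m + 1 + i) (by omega) (by omega)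
      nlinarith

theorem exists_root_of_mul_neg {f : ℝ → ℝ} (hf : Continuous f) {u v : ℝ} (huv : u < v)
    (h : f u * f v < 0) : ∃ r, u < r ∧ r < v ∧ f r = 0 := by
  rcases mul_neg_iff.1 h with ⟨hu, hv⟩ | ⟨hu, hv⟩
  · obtain ⟨r, hr, h0⟩ := intermediate_value_Ioo' huv.le hf.continuousOn ⟨hv, hu⟩
    exact ⟨r, hr.1, hr.2, h0⟩
  · obtain ⟨r, hr, h0⟩ := intermediate_value_Ioo huv.le hf.continuousOn ⟨hu, hv⟩
    exact ⟨r, hr.1, hr.2, h0⟩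

/-- Extending a valid coefficient sequence by a coefficient which is at most the maximum of
`y * rev a k y` before the first root. -/
theorem Valid.extend {a : ℕ → ℝ} {k : ℕ} (h : Valid a (k + 1)) {S : Multiset ℝ}
    (hS : IsRootSet a (k + 1) S) {x : ℝ} (hx : IsCrit S x) (hpos : 0 < a (k + 2))
    (hle : a (k + 2) ≤ x * rev a (k + 1) x) : Valid a (k + 2) := by
  have hpos' : ∀ i ≤ k + 2, 0 < a i := by
    intro i hi
    rcases Nat.lt_or_eq_of_le hi with h1 | rfl
    · exact h.pos i (by omega)
    · exact hpos
  refine ⟨h.zero, hpos', ?_⟩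
  intro i hi
  rcases Nat.lt_or_eq_of_le hi with h1 | rfl
  · exact h.real i (by omega)
  apply RealRooted.of_card_roots h.zero hpos'
  -- the least roots
  have hτ : ∀ m, ∃ t, m ≤ k → 0 < t ∧ rev a (m + 1) t = 0 ∧
      (∀ U, IsRootSet a (m + 1) U → ∀ u ∈ U, t ≤ u) := by
    intro m
    by_cases hm : m ≤ k
    · obtain ⟨U, hU⟩ := h.exists_isRootSet (i := m + 1) (by omega)
      obtain ⟨t, ht, hmin⟩ := exists_min_mem hU.ne_zero
      refine ⟨t, fun _ => ⟨hU.pos t ht, hU.mem_iff.1 ht, ?_⟩⟩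
      intro V hV u hu
      exact hmin u (hU.mem_iff.2 (hV.mem_iff.1 hu))
    · exact ⟨0, fun h => absurd h hm⟩
  choose τ hτ using hτ
  have hstep : ∀ m, m < k → τ (m + 1) < τ m := by
    intro m hm
    obtain ⟨U, hU⟩ := h.exists_isRootSet (i := m + 1) (by omega)
    obtain ⟨V, hV⟩ := h.exists_isRootSet (i := m + 1 + 1) (by omega)
    obtain ⟨_, _, h2⟩ := hτ (m + 1) (by omega)
    obtain ⟨_, h3, _⟩ := hτ m (by omega)
    exact hU.lt_of_forall_le hV (h2 V hV) _ (hU.mem_iff.2 h3)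
  have hanti : ∀ d m, m + d ≤ k → τ (m + d) ≤ τ m := by
    intro d
    induction d with
    | zero => simp
    | succ d ih =>
      intro m hm
      exact ((hstep (m + d) (by omega)).le).trans (ih m (by omega))
  have hanti' : ∀ m n, m ≤ n → n ≤ k → τ n ≤ τ m := by
    intro m n hmn hn
    obtain ⟨d, rfl⟩ := Nat.exists_eq_add_of_le hmn
    exact hanti d m hn
  have hxτ : x < τ k := hx.lt _ (hS.mem_iff.2 (hτ k le_rfl).2.1)
  have hratio : ∀ m q, m ≤ k → m + 2 ≤ q → q ≤ k + 1 → a (q + 1) < τ m * a q := by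
    intro m q hm hmq hq
    rcases Nat.lt_or_eq_of_le hq with h1 | rfl
    · obtain ⟨q, rfl⟩ : ∃ p, q = p + 1 := ⟨q - 1, by omega⟩
      obtain ⟨U, hU⟩ := h.exists_isRootSet (i := q + 1 + 1) (by omega)
      obtain ⟨_, h2, _⟩ := hτ (q + 1) (by omega)
      have h3 := hU.coeff_le_mul (h.pos _ (by omega)) (hU.mem_iff.2 h2)
      have h4 := hstep q (by omega)
      have h5 := hanti' m q (by omega) (by omega)
      have h6 := h.pos (q + 1) (by omega)
      nlinarith
    · have h2 := hanti' m k hm le_rfl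
      have h3 := h.pos (k + 1) le_rfl
      have h4 := hS.rev_lt_coeff hx.pos fun s hs => (hx.lt s hs).le
      have := hx.pos
      have : x * rev a (k + 1) x < x * a (k + 1) := by nlinarith
      have : x * a (k + 1) < τ m * a (k + 1) := by nlinarith
      linarith
  have hsign : ∀ m, m ≤ k → (Even (k - m) → 0 < rev a (k + 2) (τ m)) ∧
      (Odd (k - m) → rev a (k + 2) (τ m) < 0) := by
    intro m hm
    have h1 := rev_sign_alternates (hτ m hm).1 (hτ m hm).2.1 (k - m)
      (fun j hj => hpos' j (by omega)) fun q h1 h2 => hratio m q hm (by omega) (by omega)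
    have e : m + 1 + 1 + (k - m) = k + 2 := by omega
    rw [e] at h1
    exact ⟨fun h => hpos.trans_le (h1.1 h), h1.2⟩
  have hρ : ∀ m, ∃ r, m < k → τ (m + 1) < r ∧ r < τ m ∧ rev a (k + 2) r = 0 := by
    intro m
    by_cases hm : m < k
    · have h1 := hsign m hm.le
      have h2 := hsign (m + 1) hm
      have e : k - m = (k - (m + 1)) + 1 := by omega
      rw [e] at h1
      have h3 : rev a (k + 2) (τ (m + 1)) * rev a (k + 2) (τ m) < 0 := by
        rcases Nat.even_or_odd (k - (m + 1)) with he | ho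
        · exact mul_neg_of_pos_of_neg (h2.1 he) (h1.2 he.add_one)
        · exact mul_neg_of_neg_of_pos (h2.2 ho) (h1.1 ho.add_one)
      obtain ⟨r, hr⟩ := exists_root_of_mul_neg (continuous_rev a (k + 2)) (hstep m hm) h3
      exact ⟨r, fun _ => hr⟩
    · exact ⟨0, fun h => absurd h hm⟩
  choose ρ hρ using hρ
  have hlt : ∀ m n, m < n → n < k → ρ n < ρ m := by
    intro m n hmn hn
    have h1 := (hρ n hn).2.1
    have h2 := (hρ m (by omega)).1
    have h3 := hanti' (m + 1) n hmn hn.le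
    linarith
  have hinj : Set.InjOn ρ (Finset.range k) := by
    intro m hm n hn hmn
    simp only [Finset.coe_range, Set.mem_Iio] at hm hn
    rcases lt_trichotomy m n with h1 | h1 | h1
    · exact absurd hmn (hlt m n h1 hn).ne'
    · exact h1
    · exact absurd hmn (hlt n m h1 hm).ne
  have hbig : ∀ m < k, τ k < ρ m := fun m hm =>
    (hanti' (m + 1) k hm le_rfl).trans_lt (hρ m hm).1
  have hτk : 0 < rev a (k + 2) (τ k) := (hsign k le_rfl).1 (by simp)
  have hfac : ∃ r s Q, r < τ k ∧ s < τ k ∧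
      revPoly a (k + 2) = (X - C r) * ((X - C s) * Q) := by
    rcases hle.lt_or_eq with hlt | heq
    · have hneg : rev a (k + 2) x < 0 := by simp only [rev] at hlt ⊢; linarith
      obtain ⟨r, _, h1, hr⟩ := exists_root_of_mul_neg (continuous_rev a (k + 2)) hx.pos
        (mul_neg_of_pos_of_neg (by rwa [rev_zero_right]) hneg)
      obtain ⟨s, h2, h3, hs⟩ := exists_root_of_mul_neg (continuous_rev a (k + 2)) hxτ
        (mul_neg_of_neg_of_pos hneg hτk)
      obtain ⟨Q, hQ⟩ := exists_factor_of_ne (P := revPoly a (k + 2)) (r := r) (s := s)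
        (by rw [eval_revPoly, hr]) (by rw [eval_revPoly, hs]) (by linarith)
      exact ⟨r, s, Q, by linarith, h3, hQ⟩
    · obtain ⟨Q, hQ⟩ := exists_factor_of_double_root (P := revPoly a (k + 2)) (r := x)
        (by rw [eval_revPoly]; simp only [rev] at heq ⊢; linarith) (by
          rw [eval_derivative_revPoly]
          have h1 := hS.revSlope_eq fun h => (hx.lt x h).false
          have h2 := hx.mul_rootSum
          have : revSlope a (k + 2) x = rev a (k + 1) x - x * revSlope a (k + 1) x := rfl
          rw [this, h1, hS.rev_eq]
          linear_combination (rootProd S x) * h2)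
      exact ⟨x, x, Q, hxτ, hxτ, hQ⟩
  obtain ⟨r, s, Q, hr, hs, hQ⟩ := hfac
  exact card_roots_of_factor (revPoly_ne_zero h.zero _) (natDegree_revPoly_le a _) hQ ρ hinj
    (fun i hi => by rw [eval_revPoly]; exact (hρ i hi).2.2)
    (fun i hi => (hr.trans (hbig i hi)).ne') fun i hi => (hs.trans (hbig i hi)).ne'

/-- The coefficient `a_{k+1}` is as large as possible given the previous ones. -/
def Greedy (a : ℕ → ℝ) (k : ℕ) : Prop :=
  ∀ S x, IsRootSet a k S → IsCrit S x → a (k + 1) = x * rev a k x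

theorem IsCrit.notMem {S : Multiset ℝ} {x y : ℝ} (hx : IsCrit S x) (hy : y ≤ x) : y ∉ S :=
  fun h => (hx.lt y h).not_ge hy

theorem IsCrit.mul_rootSum_lt_one {S : Multiset ℝ} {x y : ℝ} (hx : IsCrit S x) (hy0 : 0 ≤ y)
    (hy : y < x) : y * rootSum S y < 1 := by
  rw [← hx.mul_rootSum]
  refine mul_rootSum_lt hy0 hy hx.lt ?_
  rintro rfl
  have := hx.mul_rootSum
  simp [rootSum] at this

theorem IsCrit.le_of_one_le {S : Multiset ℝ} {x y : ℝ} (hx : IsCrit S x) (hy0 : 0 ≤ y)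
    (h1 : 1 ≤ y * rootSum S y) : x ≤ y := by
  by_contra h
  exact absurd (hx.mul_rootSum_lt_one hy0 (not_le.1 h)) h1.not_gt

namespace IsRootSet

variable {a : ℕ → ℝ} {k : ℕ} {S T : Multiset ℝ} {x y z : ℝ}

theorem revSlope_succ (h : IsRootSet a k S) (hy : y ∉ S) :
    revSlope a (k + 1) y = rootProd S y * (1 - y * rootSum S y) := by
  simp only [revSlope]
  rw [h.revSlope_eq hy, h.rev_eq]
  ring

theorem revSlope_crit (h : IsRootSet a k S) (hx : IsCrit S x) : revSlope a (k + 1) x = 0 := by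
  rw [h.revSlope_succ (hx.notMem le_rfl), hx.mul_rootSum]
  ring

theorem revSlope_succ_pos (h : IsRootSet a k S) (hx : IsCrit S x) (hy0 : 0 ≤ y) (hy : y < x) :
    0 < revSlope a (k + 1) y := by
  rw [h.revSlope_succ (hx.notMem hy.le)]
  have h1 := hx.mul_rootSum_lt_one hy0 hy
  have h2 := rootProd_pos (S := S) (y := y) fun s hs => hy.trans (hx.lt s hs)
  exact mul_pos h2 (by linarith)

theorem crit_lt_crit (h : IsRootSet a k S) (hT : IsRootSet a (k + 1) T) (hx : IsCrit S x)
    (hz : IsCrit T z) : z < x := by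
  by_contra hzx
  push Not at hzx
  have hlt : ∀ t ∈ T, x < t := fun t ht => hzx.trans_lt (hz.lt t ht)
  have h1 := h.revSlope_crit hx
  rw [hT.revSlope_eq fun hx => (hlt x hx).false] at h1
  have h2 := mul_pos (rootProd_pos hlt) (rootSum_pos hlt hT.ne_zero)
  linarith

theorem crit_le_of_greedy (h : IsRootSet a k S) (hT : IsRootSet a (k + 1) T) (hx : IsCrit S x)
    (hg : Greedy a k) : ∀ t ∈ T, x ≤ t := by
  intro t ht
  by_contra htx
  push Not at htx
  have h1 := h.mul_rev_lt hx (hT.pos t ht).le (fun s hs => (htx.trans (hx.lt s hs)).le) htx.ne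
  have h2 := hT.mem_iff.1 ht
  simp only [rev] at h2
  have := hg S x h hx
  linarith

theorem rev_crit_of_greedy (h : IsRootSet a k S) (hx : IsCrit S x) (hg : Greedy a k) :
    rev a (k + 1) x = 0 := by
  simp only [rev]
  rw [hg S x h hx]
  ring

theorem three_mul_crit_le (h : IsRootSet a k S) (hT : IsRootSet a (k + 1) T) (hx : IsCrit S x)
    (hz : IsCrit T z) (hg : Greedy a k) : 3 * z ≤ x := by
  have hxT : x ∈ T := hT.mem_iff.2 (h.rev_crit_of_greedy hx hg)
  have hzx := hz.lt x hxT
  obtain ⟨U, rfl⟩ := Multiset.exists_cons_of_mem hxT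
  have hxU : x ∈ U := by
    by_contra hxU
    have h1 := hasDerivAt_rev a (k + 1) x
    rw [h.revSlope_crit hx] at h1
    have e : rev a (k + 1) = fun y => (x - y) * rootProd U y :=
      funext fun y => by rw [hT.rev_eq, rootProd_cons]
    rw [e] at h1
    have h2 := h1.unique (((hasDerivAt_id x).const_sub x).mul (hasDerivAt_rootProd hxU))
    simp only [id, sub_self, zero_mul, add_zero, neg_mul, one_mul, neg_zero, zero_eq_neg] at h2
    exact hxU (rootProd_eq_zero_iff.1 h2)
  have hzU : ∀ s ∈ U, z < s := fun s hs => hz.lt s (Multiset.mem_cons_of_mem hs)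
  have h1 := inv_le_rootSum hzU hxU
  have h2 := hz.mul_rootSum
  rw [rootSum_cons] at h2
  have h3 : 0 < x - z := by linarith
  have h4 : 2 * z * (x - z)⁻¹ ≤ 1 := by nlinarith [hz.pos]
  rw [mul_inv_le_iff₀ h3] at h4
  linarith

theorem crit_le_contraction (h : IsRootSet a k S) (hT : IsRootSet a (k + 1) T) (hx : IsCrit S x)
    (hz : IsCrit T z) (hg : Greedy a k) (h3 : ∀ s ∈ S, 3 * x ≤ s) : z ≤ 0.315 * x := by
  have hx0 := hx.pos
  have hyx : 0.315 * x < x := by linarith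
  have hyT : ∀ t ∈ T, 0.315 * x < t := fun t ht =>
    hyx.trans_le (h.crit_le_of_greedy hT hx hg t ht)
  apply hz.le_of_one_le (by linarith)
  have h1 := contraction_test hx0 h3 hx.mul_rootSum
  have h4 : rev a (k + 1) (0.315 * x) ≤ 0.315 * x * revSlope a (k + 1) (0.315 * x) := by
    rw [h.revSlope_succ (hx.notMem hyx.le)]
    simp only [rev]
    rw [hg S x h hx, h.rev_eq, h.rev_eq]
    nlinarith
  rw [hT.revSlope_eq fun hy => (hyT _ hy).false, hT.rev_eq] at h4
  have h5 := rootProd_pos hyT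
  by_contra h6
  push Not at h6
  nlinarith

/-- The quotient `y * c_k(y) / c_{k+1}(y)` drops by a factor two on the lower third. -/
theorem halving_of_le_third (h : IsRootSet a k S) (hx : IsCrit S x) (hz0 : 0 ≤ z) (hz : z < x)
    (hy0 : 0 ≤ y) (hy : 3 * y ≤ z) :
    y * revSlope a k y * revSlope a (k + 1) z ≤
      1 / 2 * (z * revSlope a k z * revSlope a (k + 1) y) := by
  have hyx : y < x := by linarith
  have hzS : ∀ s ∈ S, z < s := fun s hs => hz.trans (hx.lt s hs)
  rw [h.revSlope_succ (hx.notMem hz.le), h.revSlope_succ (hx.notMem hyx.le),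
    h.revSlope_eq (hx.notMem hz.le), h.revSlope_eq (hx.notMem hyx.le)]
  have h1 := hx.mul_rootSum_lt_one hz0 hz
  have h2 := rootSum_mono (x := y) (y := z) (by linarith) hzS
  have h0 := rootSum_nonneg (S := S) (y := y) fun s hs => hyx.trans (hx.lt s hs)
  have h3 : 3 * (y * rootSum S y) ≤ z * rootSum S z := by nlinarith
  have h4 : 0 ≤ y * rootSum S y := by positivity
  have h5 : 0 < rootProd S y * rootProd S z :=
    mul_pos (rootProd_pos fun s hs => hyx.trans (hx.lt s hs)) (rootProd_pos hzS)
  have h6 : y * rootSum S y * (1 - z * rootSum S z) ≤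
      1 / 2 * (z * rootSum S z * (1 - y * rootSum S y)) := by nlinarith
  have := mul_le_mul_of_nonneg_left h6 h5.le
  linarith

/-- After two greedy steps the quotient `y * c_k(y) / c_{k+1}(y)` even drops by a factor four. -/
theorem quartering_of_greedy (h : IsRootSet a k S) (hT : IsRootSet a (k + 1) T) (hx : IsCrit S x)
    (hz : IsCrit T z) (hg : Greedy a k) (hy0 : 0 ≤ y) (hy : y ≤ 0.315 * z) :
    y * revSlope a k y * revSlope a (k + 1) z ≤
      1 / 4 * (z * revSlope a k z * revSlope a (k + 1) y) := by
  have hzx := h.crit_lt_crit hT hx hz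
  have hz0 := hz.pos
  have hzS : ∀ s ∈ S, z < s := fun s hs => hzx.trans (hx.lt s hs)
  have hyx : y < x := by linarith
  have hcrit : x * rootProd S x = z * rootProd S z * (2 - z * rootSum S z) := by
    have h1 := hT.revSlope_eq (hz.notMem le_rfl)
    rw [h.revSlope_succ (hx.notMem hzx.le), ← hT.rev_eq] at h1
    simp only [rev] at h1
    rw [hg S x h hx, h.rev_eq, h.rev_eq] at h1
    have h2 := hz.mul_rootSum
    linear_combination (-z) * h1 - (x * rootProd S x - z * rootProd S z) * h2
  have h4 := quarter_growth hx.lt hx.mul_rootSum hz0 hzx hcrit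
  rw [h.revSlope_succ (hx.notMem hzx.le), h.revSlope_succ (hx.notMem hyx.le),
    h.revSlope_eq (hx.notMem hzx.le), h.revSlope_eq (hx.notMem hyx.le)]
  have h1 := hx.mul_rootSum_lt_one hz0.le hzx
  have h2 := mul_rootSum_le hy0 hy fun s hs => (show 0.315 * z < z by linarith).trans (hzS s hs)
  have h3 : 0 ≤ z * rootSum S z := mul_nonneg hz0.le (rootSum_nonneg hzS)
  have h5 : 0 < rootProd S y * rootProd S z :=
    mul_pos (rootProd_pos fun s hs => hyx.trans (hx.lt s hs)) (rootProd_pos hzS)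
  have h6 : y * rootSum S y * (1 - z * rootSum S z) ≤
      1 / 4 * (z * rootSum S z * (1 - y * rootSum S y)) := by nlinarith
  have := mul_le_mul_of_nonneg_left h6 h5.le
  linarith

end IsRootSet

/-- The quotients of two coefficient sequences. -/
noncomputable def quot (a a' : ℕ → ℝ) (k : ℕ) : ℝ := a' k / a k

/-- First differences of the quotients. -/
noncomputable def quotDiff (a a' : ℕ → ℝ) : ℕ → ℝ
  | 0 => 0
  | k + 1 => quot a a' (k + 1) - quot a a' k

/-- Second differences of the quotients. -/
noncomputable def quotDiff₂ (a a' : ℕ → ℝ) (k : ℕ) : ℝ :=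
  quotDiff a a' (k + 1) - quotDiff a a' k

/-- The remainder in the expansion of `rev a'` around `rev a`. -/
noncomputable def revRem (a a' : ℕ → ℝ) : ℕ → ℝ → ℝ
  | 0, _ => 0
  | k + 1, y => revSlope a k y * quotDiff₂ a a' k - y * revRem a a' k y

theorem rev_expansion {a a' : ℕ → ℝ} (k : ℕ) (ha : ∀ i ≤ k, a i ≠ 0) (y : ℝ) :
    rev a' k y = quot a a' k * rev a k y + quotDiff a a' k * (y * revSlope a k y) +
      y ^ 2 * revRem a a' k y := by
  induction k with
  | zero =>
    have := ha 0 le_rfl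
    simp only [rev, quot, quotDiff, revRem]
    field_simp
    ring
  | succ k ih =>
    have h1 : a' (k + 1) = quot a a' (k + 1) * a (k + 1) :=
      (div_mul_cancel₀ _ (ha (k + 1) le_rfl)).symm
    simp only [rev, revSlope, revRem, quotDiff₂]
    rw [ih fun i hi => ha i (by omega), h1]
    simp only [quotDiff]
    ring

/-- The conclusion of the comparison of two greedy continuations, at index `m + 1`. -/
structure RemBound (a a' : ℕ → ℝ) (m : ℕ) (z α : ℝ) : Prop where
  diff₂_pos : 0 < quotDiff₂ a a' m
  diff_pos : 0 < quotDiff a a' (m + 1)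
  lower : ∀ y, 0 ≤ y → y ≤ z → α * (revSlope a m y * quotDiff₂ a a' m) ≤ revRem a a' (m + 1) y
  upper : ∀ y, 0 ≤ y → y ≤ z → revRem a a' (m + 1) y ≤ revSlope a m y * quotDiff₂ a a' m

theorem quotDiff_eq_zero {a a' : ℕ → ℝ} {m : ℕ} (ha : ∀ i ≤ m, a i ≠ 0)
    (h : ∀ i ≤ m, a' i = a i) {i : ℕ} (hi : i ≤ m) : quotDiff a a' i = 0 := by
  cases i with
  | zero => rfl
  | succ i =>
    simp only [quotDiff, quot]
    rw [h (i + 1) hi, h i (by omega), div_self (ha _ hi), div_self (ha _ (by omega)), sub_self]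

theorem revRem_eq_zero {a a' : ℕ → ℝ} {m : ℕ} (ha : ∀ i ≤ m, a i ≠ 0)
    (h : ∀ i ≤ m, a' i = a i) {i : ℕ} (hi : i ≤ m) (y : ℝ) : revRem a a' i y = 0 := by
  induction i with
  | zero => rfl
  | succ i ih =>
    simp only [revRem, quotDiff₂]
    rw [ih (by omega), quotDiff_eq_zero ha h hi, quotDiff_eq_zero ha h (by omega : i ≤ m)]
    ring

theorem RemBound.initial {a a' : ℕ → ℝ} {m : ℕ} (ha : ∀ i ≤ m + 1, 0 < a i)
    (h : ∀ i ≤ m, a' i = a i) (hlt : a (m + 1) < a' (m + 1)) (z : ℝ) : RemBound a a' m z 1 := by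
  have ha' : ∀ i ≤ m, a i ≠ 0 := fun i hi => (ha i (by omega)).ne'
  have h0 := quotDiff_eq_zero ha' h (le_refl m)
  have h1 : 0 < quotDiff a a' (m + 1) := by
    simp only [quotDiff, quot]
    rw [h m le_rfl, div_self (ha' m le_rfl), sub_pos, one_lt_div (ha _ le_rfl)]
    exact hlt
  have h2 : ∀ y, revRem a a' (m + 1) y = revSlope a m y * quotDiff₂ a a' m := by
    intro y
    simp only [revRem]
    rw [revRem_eq_zero ha' h le_rfl]
    ring
  exact ⟨by rw [quotDiff₂, h0, sub_zero]; exact h1, h1, fun y _ _ => by rw [h2, one_mul],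
    fun y _ _ => (h2 y).le⟩

/-- At the critical point the remainder of the next order is nonnegative. -/
theorem revRem_nonneg_of_greedy {a a' : ℕ → ℝ} {m : ℕ} (ha : Valid a (m + 2))
    (ha' : Valid a' (m + 2)) (hg : Greedy a (m + 1))
    (hdiff : 0 ≤ quotDiff a a' (m + 1)) {T : Multiset ℝ} (hT : IsRootSet a (m + 1) T) {z : ℝ}
    (hz : IsCrit T z) (hg' : Greedy a' (m + 1)) : 0 ≤ revRem a a' (m + 2) z := by
  obtain ⟨U, hU⟩ := ha'.exists_isRootSet (i := m + 1) (by omega)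
  obtain ⟨x, hx⟩ := hU.exists_isCrit
  have hz0 := hz.pos
  have p1 := ha.pos (m + 1) (by omega)
  have p2 := ha.pos m (by omega)
  have p3 := ha'.pos (m + 1) (by omega)
  have p4 := ha'.pos m (by omega)
  have hzU : ∀ u ∈ U, z ≤ u := by
    intro u hu
    have h1 := hT.crit_mul_le p1 hz
    have h2 := hU.coeff_le_mul p3 hu
    have h3 : a' m * a (m + 1) ≤ a' (m + 1) * a m := by
      simp only [quotDiff, quot] at hdiff
      rw [sub_nonneg, div_le_div_iff₀ p2 p1] at hdiff
      exact hdiff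
    have h4 : z * (a m * a' m) ≤ u * (a m * a' m) := by nlinarith
    exact le_of_mul_le_mul_right h4 (by positivity)
  have h1 := hU.mul_rev_le hx hz0.le hzU
  rw [← hg' U x hU hx] at h1
  have h2 := rev_expansion (a := a) (a' := a') (m + 2) (fun i hi => (ha.pos i hi).ne') z
  rw [hT.rev_crit_of_greedy hz hg, hT.revSlope_crit hz] at h2
  have h3 : rev a' (m + 2) z = a' (m + 2) - z * rev a' (m + 1) z := rfl
  have h4 : 0 ≤ z ^ 2 * revRem a a' (m + 2) z := by linarith
  exact nonneg_of_mul_nonneg_right h4 (by positivity)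

theorem RemBound.mul_le {a a' : ℕ → ℝ} {m : ℕ} {z α : ℝ} (hz : 0 ≤ z)
    (h : RemBound a a' m z α) (hrem : 0 ≤ revRem a a' (m + 2) z) :
    α * (z * revSlope a m z) * quotDiff₂ a a' m ≤
      revSlope a (m + 1) z * quotDiff₂ a a' (m + 1) := by
  have h1 := h.lower z hz le_rfl
  have h2 : revRem a a' (m + 2) z =
    revSlope a (m + 1) z * quotDiff₂ a a' (m + 1) - z * revRem a a' (m + 1) z := rfl
  nlinarith

theorem RemBound.step {a a' : ℕ → ℝ} {m : ℕ} {z u α : ℝ} (hα : 0 < α) (hz : 0 < z) (huz : u ≤ z)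
    (h : RemBound a a' m z α) (hrem : 0 ≤ revRem a a' (m + 2) z)
    (hm : ∀ y, 0 ≤ y → y ≤ z → 0 < revSlope a m y)
    (hm' : ∀ y, 0 ≤ y → y ≤ z → 0 < revSlope a (m + 1) y)
    (hdrop : ∀ y, 0 ≤ y → y ≤ u → y * revSlope a m y * revSlope a (m + 1) z ≤
      α / 2 * (z * revSlope a m z * revSlope a (m + 1) y)) :
    RemBound a a' (m + 1) u (1 / 2) := by
  have h1 := h.mul_le hz.le hrem
  have hw := h.diff₂_pos
  have c1 := hm z hz.le le_rfl
  have c2 := hm' z hz.le le_rfl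
  have hw' : 0 < quotDiff₂ a a' (m + 1) := by
    by_contra hn
    push Not at hn
    have : 0 < α * (z * revSlope a m z) * quotDiff₂ a a' m := by positivity
    nlinarith
  have hdiff : quotDiff a a' (m + 2) = quotDiff a a' (m + 1) + quotDiff₂ a a' (m + 1) := by
    simp only [quotDiff₂]
    ring
  have hrem_eq : ∀ y, revRem a a' (m + 2) y =
    revSlope a (m + 1) y * quotDiff₂ a a' (m + 1) - y * revRem a a' (m + 1) y := fun _ => rfl
  refine ⟨hw', by rw [hdiff]; exact add_pos h.diff_pos hw', ?_, ?_⟩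
  · intro y hy0 hyu
    have h2 := h.upper y hy0 (hyu.trans huz)
    have h3 := hdrop y hy0 hyu
    have c3 := hm' y hy0 (hyu.trans huz)
    rw [hrem_eq]
    have h4 : y * revRem a a' (m + 1) y ≤ y * revSlope a m y * quotDiff₂ a a' m := by nlinarith
    have h5 := mul_le_mul_of_nonneg_right h3 hw.le
    have h6 := mul_le_mul_of_nonneg_right h1 c3.le
    have h7 : y * revSlope a m y * quotDiff₂ a a' m * revSlope a (m + 1) z ≤
        1 / 2 * (revSlope a (m + 1) y * quotDiff₂ a a' (m + 1)) * revSlope a (m + 1) z := by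
      linarith
    have h8 := le_of_mul_le_mul_right h7 c2
    linarith
  · intro y hy0 hyu
    have h2 := h.lower y hy0 (hyu.trans huz)
    have c3 := hm y hy0 (hyu.trans huz)
    rw [hrem_eq]
    have : 0 ≤ revRem a a' (m + 1) y := le_trans (by positivity) h2
    nlinarith

/-- Second differences of the quotients of two greedy continuations grow at least geometrically,
with constants depending only on one of them. -/
theorem exists_growth {a : ℕ → ℝ} {n j : ℕ} (ha : Valid a n) (hj : 1 ≤ j)
    (hg : ∀ k, j < k → k < n → Greedy a k) :
    ∃ κ : ℕ → ℝ, (∀ m, 0 < κ m) ∧ ∀ a', Valid a' n → (∀ i ≤ j, a' i = a i) →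
      a (j + 1) < a' (j + 1) → (∀ k, j < k → k < n → Greedy a' k) →
      ∀ m, j ≤ m → m + 2 ≤ n → 0 < quotDiff a a' (m + 1) ∧ 0 < quotDiff₂ a a' m ∧
        κ m * quotDiff₂ a a' m ≤ quotDiff₂ a a' (m + 1) := by
  have hS : ∀ k, ∃ S, k ≤ n → IsRootSet a k S := by
    intro k
    by_cases hk : k ≤ n
    · obtain ⟨S, hS⟩ := ha.exists_isRootSet hk
      exact ⟨S, fun _ => hS⟩
    · exact ⟨0, fun h => absurd h hk⟩
  choose S hS using hS
  have hξ : ∀ k, ∃ x, 1 ≤ k → k ≤ n → IsCrit (S k) x := by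
    intro k
    by_cases hk : 1 ≤ k ∧ k ≤ n
    · obtain ⟨l, rfl⟩ : ∃ l, k = l + 1 := ⟨k - 1, by omega⟩
      obtain ⟨x, hx⟩ := (hS _ hk.2).exists_isCrit
      exact ⟨x, fun _ _ => hx⟩
    · exact ⟨0, fun h1 h2 => absurd ⟨h1, h2⟩ hk⟩
  choose ξ hξ using hξ
  have hc : ∀ m, 1 ≤ m → m + 1 ≤ n → (∀ y, 0 ≤ y → y ≤ ξ (m + 1) → 0 < revSlope a m y) ∧
      ∀ y, 0 ≤ y → y ≤ ξ (m + 1) → 0 < revSlope a (m + 1) y := by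
    intro m hm1 hm
    have hlt := (hS m (by omega)).crit_lt_crit (hS _ hm) (hξ m hm1 (by omega))
      (hξ _ (by omega) hm)
    refine ⟨fun y _ hy => ?_, fun y hy0 hy =>
      (hS m (by omega)).revSlope_succ_pos (hξ m hm1 (by omega)) hy0 (hy.trans_lt hlt)⟩
    have h1 := (hξ m hm1 (by omega)).notMem (y := y) (by linarith)
    rw [(hS m (by omega)).revSlope_eq h1]
    have hys : ∀ s ∈ S m, y < s := fun s hs =>
      (hy.trans_lt hlt).trans ((hξ m hm1 (by omega)).lt s hs)
    obtain ⟨l, rfl⟩ : ∃ l, m = l + 1 := ⟨m - 1, by omega⟩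
    exact mul_pos (rootProd_pos hys) (rootSum_pos hys (hS (l + 1) (by omega)).ne_zero)
  refine ⟨fun m => if j ≤ m ∧ m + 2 ≤ n then
      1 / 2 * (ξ (m + 1) * revSlope a m (ξ (m + 1)) / revSlope a (m + 1) (ξ (m + 1))) else 1,
    ?_, ?_⟩
  · intro m
    dsimp only
    split_ifs with h
    · have h0 := (hξ (m + 1) (by omega) (by omega)).pos
      have h1 := (hc m (by omega) (by omega)).1 _ h0.le le_rfl
      have h2 := (hc m (by omega) (by omega)).2 _ h0.le le_rfl
      positivity
    · exact one_pos
  intro a' ha' hagree hlt hg'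
  have hrem : ∀ m, j ≤ m → m + 2 ≤ n → 0 ≤ quotDiff a a' (m + 1) →
      0 ≤ revRem a a' (m + 2) (ξ (m + 1)) := fun m hm hmn hd =>
    revRem_nonneg_of_greedy (ha.mono hmn) (ha'.mono hmn) (hg _ (by omega) (by omega)) hd
      (hS _ (by omega)) (hξ _ (by omega) (by omega)) (hg' _ (by omega) (by omega))
  have hmain : ∀ m, j ≤ m → m + 1 ≤ n →
      RemBound a a' m (ξ (m + 1)) (if m = j then 1 else 1 / 2) := by
    intro m hm
    induction m, hm using Nat.le_induction with
    | base =>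
      intro hn
      rw [if_pos rfl]
      exact RemBound.initial (fun i hi => ha.pos i (by omega)) hagree hlt _
    | succ m hm ih =>
      intro hn
      have ih := ih (by omega)
      rw [if_neg (by omega)]
      have hz := hξ (m + 1) (by omega) (by omega)
      have hu := hξ (m + 1 + 1) (by omega) hn
      have hx := hξ m (by omega) (by omega)
      have hSm := hS m (by omega)
      have hSm1 := hS (m + 1) (by omega)
      have hSm2 := hS (m + 1 + 1) hn
      have hgm := hg (m + 1) (by omega) (by omega)
      have h3 := hSm1.three_mul_crit_le hSm2 hz hu hgm
      have hu0 := hu.pos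
      refine ih.step (by split_ifs <;> norm_num) hz.pos (by linarith)
        (hrem m hm (by omega) ih.diff_pos.le) (hc m (by omega) (by omega)).1
        (hc m (by omega) (by omega)).2 ?_
      intro y hy0 hy
      by_cases hmj : m = j
      · rw [if_pos hmj]
        exact hSm.halving_of_le_third hx hz.pos.le (hSm.crit_lt_crit hSm1 hx hz) hy0 (by linarith)
      · rw [if_neg hmj]
        have hgm' := hg m (by omega) (by omega)
        have h4 := hSm.three_mul_crit_le hSm1 hx hz hgm'
        have h5 := hSm1.crit_le_contraction hSm2 hz hu hgm fun s hs =>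
          h4.trans (hSm.crit_le_of_greedy hSm1 hx hgm' s hs)
        have := hSm.quartering_of_greedy hSm1 hx hz hgm' hy0 (hy.trans h5)
        linarith
  intro m hm hmn
  have h1 := hmain m hm (by omega)
  refine ⟨h1.diff_pos, h1.diff₂_pos, ?_⟩
  have h0 := (hξ (m + 1) (by omega) (by omega)).pos
  have h2 := h1.mul_le h0.le (hrem m hm hmn h1.diff_pos.le)
  have c1 := (hc m (by omega) (by omega)).1 _ h0.le le_rfl
  have c2 := (hc m (by omega) (by omega)).2 _ h0.le le_rfl
  dsimp only
  rw [if_pos ⟨hm, hmn⟩]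
  have h3 : (1 / 2 : ℝ) ≤ if m = j then 1 else 1 / 2 := by split_ifs <;> norm_num
  have h4 : 0 < ξ (m + 1) * revSlope a m (ξ (m + 1)) * quotDiff₂ a a' m :=
    mul_pos (mul_pos h0 c1) h1.diff₂_pos
  have h5 : 1 / 2 * (ξ (m + 1) * revSlope a m (ξ (m + 1)) * quotDiff₂ a a' m) ≤
      revSlope a (m + 1) (ξ (m + 1)) * quotDiff₂ a a' (m + 1) := by nlinarith
  rw [mul_comm] at h5
  rw [← div_le_iff₀' c2] at h5
  refine le_trans (le_of_eq ?_) h5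
  field_simp

/-- Increasing one coefficient slightly and continuing greedily decreases the last ratio. -/
theorem exists_lt_of_quotDiff_lt {a : ℕ → ℝ} {n j : ℕ} (ha : Valid a (n + 2)) (hj : 1 ≤ j)
    (hjn : j ≤ n) (hg : ∀ k, j < k → k < n + 2 → Greedy a k) :
    ∃ ε : ℝ, 0 < ε ∧ ∀ a', Valid a' (n + 2) → (∀ i ≤ j, a' i = a i) →
      a (j + 1) < a' (j + 1) → (∀ k, j < k → k < n + 2 → Greedy a' k) →
      quotDiff a a' (n + 1) < ε →
      a' (n + 1) ^ 2 / (a' n * a' (n + 2)) < a (n + 1) ^ 2 / (a n * a (n + 2)) := by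
  obtain ⟨κ, hκ, hgrow⟩ := exists_growth ha hj hg
  have hC : ∀ m, j ≤ m → m ≤ n → ∃ C : ℝ, 0 < C ∧ ∀ a', Valid a' (n + 2) →
      (∀ i ≤ j, a' i = a i) → a (j + 1) < a' (j + 1) →
      (∀ k, j < k → k < n + 2 → Greedy a' k) →
      quotDiff a a' (m + 1) ≤ C * quotDiff₂ a a' (m + 1) ∧ 1 ≤ quot a a' m := by
    intro m hm
    induction m, hm using Nat.le_induction with
    | base =>
      intro _
      refine ⟨(κ j)⁻¹, inv_pos.2 (hκ j), fun a' h1 h2 h3 h4 => ⟨?_, ?_⟩⟩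
      · have h5 := (hgrow a' h1 h2 h3 h4 j le_rfl (by omega)).2.2
        have h6 : quotDiff₂ a a' j = quotDiff a a' (j + 1) := by
          rw [quotDiff₂, quotDiff_eq_zero (fun i hi => (ha.pos i (by omega)).ne') h2 le_rfl,
            sub_zero]
        rw [h6] at h5
        rwa [inv_mul_eq_div, le_div_iff₀' (hκ j)]
      · rw [quot, h2 j le_rfl, div_self (ha.pos j (by omega)).ne']
    | succ m hm ih =>
      intro hmn
      obtain ⟨C, hC, ih⟩ := ih (by omega)
      refine ⟨(C + 1) * (κ (m + 1))⁻¹, mul_pos (by linarith) (inv_pos.2 (hκ _)),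
        fun a' h1 h2 h3 h4 => ?_⟩
      obtain ⟨i1, i2⟩ := ih a' h1 h2 h3 h4
      have h5 := (hgrow a' h1 h2 h3 h4 (m + 1) (by omega) (by omega)).2.2
      have h6 := (hgrow a' h1 h2 h3 h4 m (by omega) (by omega)).1
      constructor
      · have h7 : quotDiff a a' (m + 1 + 1) =
            quotDiff a a' (m + 1) + quotDiff₂ a a' (m + 1) := by
          rw [quotDiff₂]; ring
        have h8 : quotDiff₂ a a' (m + 1) ≤ (κ (m + 1))⁻¹ * quotDiff₂ a a' (m + 1 + 1) := by
          rwa [inv_mul_eq_div, le_div_iff₀' (hκ _)]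
        rw [h7]
        nlinarith
      · simp only [quotDiff] at h6
        linarith
  obtain ⟨C, hC0, hC⟩ := hC n hjn le_rfl
  refine ⟨C⁻¹, inv_pos.2 hC0, fun a' h1 h2 h3 h4 hε => ?_⟩
  obtain ⟨c1, c2⟩ := hC a' h1 h2 h3 h4
  have hr := (hgrow a' h1 h2 h3 h4 n hjn le_rfl).1
  set r := quotDiff a a' (n + 1) with hr_def
  set w := quotDiff₂ a a' (n + 1) with hw_def
  have e1 : quot a a' (n + 1) = quot a a' n + r := by simp only [hr_def, quotDiff]; ring
  have e2 : quot a a' (n + 2) = quot a a' (n + 1) + r + w := by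
    simp only [hr_def, hw_def, quotDiff₂, quotDiff]; ring
  have hCr : C * r < 1 := by
    have := mul_lt_mul_of_pos_left hε hC0
    rwa [mul_inv_cancel₀ hC0.ne'] at this
  have hrw : r ^ 2 < w := by nlinarith
  have hlt : quot a a' (n + 1) ^ 2 < quot a a' n * quot a a' (n + 2) := by
    rw [e2, e1]
    nlinarith
  have p0 := ha.pos n (by omega)
  have p1 := ha.pos (n + 1) (by omega)
  have p2 := ha.pos (n + 2) le_rfl
  have q0 := h1.pos n (by omega)
  have q2 := h1.pos (n + 2) le_rfl
  simp only [quot] at hlt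
  rw [div_pow, div_mul_div_comm, div_lt_div_iff₀ (by positivity) (by positivity)] at hlt
  rw [div_lt_div_iff₀ (by positivity) (by positivity)]
  linarith

/-- The largest admissible coefficient of order `k + 2`, given those of order at most `k + 1`. -/
noncomputable def maxNext (a : ℕ → ℝ) (k : ℕ) : ℝ :=
  sSup ((fun s => s * (a (k + 1) / a k) * rev a (k + 1) (s * (a (k + 1) / a k))) '' Set.Icc 0 1)

theorem maxNext_congr {a b : ℕ → ℝ} {k : ℕ} (h : ∀ i ≤ k + 1, a i = b i) :
    maxNext a k = maxNext b k := by
  simp only [maxNext]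
  rw [rev_congr h, h (k + 1) le_rfl, h k (by omega)]

theorem maxNext_eq {a : ℕ → ℝ} {k : ℕ} (ha : Valid a (k + 1)) {S : Multiset ℝ}
    (hS : IsRootSet a (k + 1) S) {x : ℝ} (hx : IsCrit S x) :
    maxNext a k = x * rev a (k + 1) x := by
  have p0 := ha.pos k (by omega)
  have p1 := ha.pos (k + 1) le_rfl
  have hx0 := hx.pos
  refine IsGreatest.csSup_eq ⟨⟨x * a k / a (k + 1), ⟨by positivity, ?_⟩, ?_⟩, ?_⟩
  · rw [div_le_one p1]
    exact hS.crit_mul_le p1 hx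
  · have : x * a k / a (k + 1) * (a (k + 1) / a k) = x := by field_simp
    simp only [this]
  · rintro _ ⟨s, ⟨hs0, hs1⟩, rfl⟩
    refine hS.mul_rev_le hx (by positivity) fun u hu => ?_
    have h1 := hS.coeff_le_mul p1 hu
    have h2 : a (k + 1) / a k ≤ u := by rwa [div_le_iff₀ p0]
    have h3 : 0 < a (k + 1) / a k := by positivity
    nlinarith

theorem maxNext_pos {a : ℕ → ℝ} {k : ℕ} (ha : Valid a (k + 1)) : 0 < maxNext a k := by
  obtain ⟨S, hS⟩ := ha.exists_isRootSet le_rfl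
  obtain ⟨x, hx⟩ := hS.exists_isCrit
  rw [maxNext_eq ha hS hx, hS.rev_eq]
  exact mul_pos hx.pos (rootProd_pos hx.lt)

theorem greedy_iff {a : ℕ → ℝ} {k : ℕ} (ha : Valid a (k + 1)) :
    Greedy a (k + 1) ↔ a (k + 2) = maxNext a k := by
  constructor
  · intro h
    obtain ⟨S, hS⟩ := ha.exists_isRootSet le_rfl
    obtain ⟨x, hx⟩ := hS.exists_isCrit
    rw [maxNext_eq ha hS hx]
    exact h S x hS hx
  · intro h S x hS hx
    rw [← maxNext_eq ha hS hx]
    exact h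

theorem Valid.le_maxNext {a : ℕ → ℝ} {k : ℕ} (ha : Valid a (k + 2)) :
    a (k + 2) ≤ maxNext a k := by
  obtain ⟨S, hS⟩ := ha.exists_isRootSet (i := k + 1) (by omega)
  obtain ⟨T, hT⟩ := ha.exists_isRootSet (i := k + 2) le_rfl
  obtain ⟨x, hx⟩ := hS.exists_isCrit
  rw [maxNext_eq (ha.mono (by omega)) hS hx]
  exact hS.coeff_le_crit hT hx

theorem IsRootSet.congr {a b : ℕ → ℝ} {k : ℕ} (h : ∀ i ≤ k, a i = b i) {S : Multiset ℝ}
    (hS : IsRootSet a k S) : IsRootSet b k S :=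
  ⟨hS.card_eq, hS.pos, fun y => by rw [← rev_congr h, hS.rev_eq]⟩

theorem Valid.congr {a b : ℕ → ℝ} {k : ℕ} (h : ∀ i ≤ k, a i = b i) (ha : Valid a k) :
    Valid b k := by
  refine ⟨by rw [← h 0 (Nat.zero_le k), ha.zero], fun i hi => by rw [← h i hi]; exact ha.pos i hi,
    fun i hi => ?_⟩
  obtain ⟨S, hS⟩ := ha.exists_isRootSet hi
  have := hS.congr fun l hl => h l (hl.trans hi)
  exact ⟨S, this.card_eq, this.pos, this.rev_eq⟩

theorem valid_update {a : ℕ → ℝ} {k : ℕ} (ha : Valid a (k + 1)) {t : ℝ} (ht0 : 0 < t)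
    (ht : t ≤ maxNext a k) : Valid (Function.update a (k + 2) t) (k + 2) := by
  have hag : ∀ i ≤ k + 1, a i = Function.update a (k + 2) t i := fun i hi => by
    rw [Function.update_of_ne (by omega)]
  obtain ⟨S, hS⟩ := ha.exists_isRootSet le_rfl
  obtain ⟨x, hx⟩ := hS.exists_isCrit
  refine (ha.congr hag).extend (hS.congr hag) hx (by simpa using ht0) ?_
  rw [← rev_congr hag, ← maxNext_eq ha hS hx]
  simpa using ht

/-- Replace the coefficient of order `k + 2` by the largest admissible one. -/
noncomputable def greedyStep (a : ℕ → ℝ) (k : ℕ) : ℕ → ℝ :=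
  Function.update a (k + 2) (maxNext a k)

/-- Replace the coefficients of order `k + 2, …, k + m + 1` successively by the largest
admissible ones. -/
noncomputable def greedyExt : ℕ → ℕ → (ℕ → ℝ) → ℕ → ℝ
  | 0, _, a => a
  | m + 1, k, a => greedyExt m (k + 1) (greedyStep a k)

theorem greedyStep_valid {a : ℕ → ℝ} {k : ℕ} (ha : Valid a (k + 1)) :
    Valid (greedyStep a k) (k + 2) :=
  valid_update ha (maxNext_pos ha) le_rfl

theorem greedyStep_of_le (a : ℕ → ℝ) {k i : ℕ} (hi : i ≤ k + 1) : greedyStep a k i = a i :=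
  Function.update_of_ne (by omega) _ _

theorem greedyExt_valid (m : ℕ) {a : ℕ → ℝ} {k : ℕ} (ha : Valid a (k + 1)) :
    Valid (greedyExt m k a) (k + 1 + m) := by
  induction m generalizing a k with
  | zero => exact ha
  | succ m ih =>
    have := ih (greedyStep_valid ha)
    rwa [show k + 1 + 1 + m = k + 1 + (m + 1) by omega] at this

theorem greedyExt_of_le (m : ℕ) (a : ℕ → ℝ) {k i : ℕ} (hi : i ≤ k + 1) :
    greedyExt m k a i = a i := by
  induction m generalizing a k with
  | zero => rfl
  | succ m ih =>
    rw [greedyExt, ih _ (by omega), greedyStep_of_le a hi]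

theorem greedyExt_eq_maxNext (m : ℕ) (a : ℕ → ℝ) {k i : ℕ} (hk : k ≤ i) (hi : i < k + m) :
    greedyExt m k a (i + 2) = maxNext (greedyExt m k a) i := by
  induction m generalizing a k with
  | zero => omega
  | succ m ih =>
    simp only [greedyExt]
    rcases Nat.lt_or_eq_of_le hk with h | rfl
    · exact ih _ h (by omega)
    · rw [greedyExt_of_le m _ (by omega),
        maxNext_congr (b := a) fun l hl => by
          rw [greedyExt_of_le m _ (by omega), greedyStep_of_le a hl]]
      simp [greedyStep]

theorem greedyExt_greedy (m : ℕ) {a : ℕ → ℝ} {k : ℕ} (ha : Valid a (k + 1)) {i : ℕ} (hk : k < i)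
    (hi : i < k + 1 + m) : Greedy (greedyExt m k a) i := by
  obtain ⟨i, rfl⟩ : ∃ l, i = l + 1 := ⟨i - 1, by omega⟩
  rw [greedy_iff ((greedyExt_valid m ha).mono (by omega))]
  exact greedyExt_eq_maxNext m a (by omega) (by omega)

section Continuity

variable {Y : Type*} [TopologicalSpace Y]

theorem continuous_rev_param {c : Y → ℕ → ℝ} (hc : ∀ i, Continuous fun t => c t i) (k : ℕ)
    {f : Y → ℝ} (hf : Continuous f) : Continuous fun t => rev (c t) k (f t) := by
  induction k with
  | zero => exact hc 0
  | succ k ih => exact (hc (k + 1)).sub (hf.mul ih)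

theorem continuous_maxNext {c : Y → ℕ → ℝ} (hc : ∀ i, Continuous fun t => c t i) {k : ℕ}
    (h0 : ∀ t, c t k ≠ 0) : Continuous fun t => maxNext (c t) k := by
  have h1 : Continuous fun p : Y × ℝ => p.2 * (c p.1 (k + 1) / c p.1 k) :=
    continuous_snd.mul (((hc (k + 1)).comp continuous_fst).div ((hc k).comp continuous_fst)
      fun p => h0 p.1)
  refine isCompact_Icc.continuous_sSup (f := fun t s => s * (c t (k + 1) / c t k) *
    rev (c t) (k + 1) (s * (c t (k + 1) / c t k))) ?_
  exact h1.mul (continuous_rev_param (c := fun p : Y × ℝ => c p.1)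
    (fun i => (hc i).comp continuous_fst) (k + 1) h1)

theorem continuous_greedyExt (m : ℕ) {c : Y → ℕ → ℝ} (hc : ∀ i, Continuous fun t => c t i) {k : ℕ}
    (hv : ∀ t, Valid (c t) (k + 1)) (i : ℕ) : Continuous fun t => greedyExt m k (c t) i := by
  induction m generalizing c k with
  | zero => exact hc i
  | succ m ih =>
    refine ih (c := fun t => greedyStep (c t) k) ?_ fun t => greedyStep_valid (hv t)
    intro l
    rcases eq_or_ne l (k + 2) with rfl | hl
    · simpa [greedyStep] using
        continuous_maxNext hc fun t => ((hv t).pos k (by omega)).ne'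
    · simpa [greedyStep, hl] using hc l

end Continuity

/-- The quotient to be minimized. -/
noncomputable def lastRatio (n : ℕ) (a : ℕ → ℝ) : ℝ := a (n + 1) ^ 2 / (a n * a (n + 2))

theorem lastRatio_greedyStep {a : ℕ → ℝ} {n : ℕ} (ha : Valid a (n + 2)) :
    lastRatio n (greedyStep a n) ≤ lastRatio n a ∧
      (lastRatio n (greedyStep a n) = lastRatio n a → a (n + 2) = maxNext a n) := by
  have h1 := ha.le_maxNext
  have p0 := ha.pos n (by omega)
  have p1 := ha.pos (n + 1) (by omega)
  have p2 := ha.pos (n + 2) le_rfl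
  have e : lastRatio n (greedyStep a n) = a (n + 1) ^ 2 / (a n * maxNext a n) := by
    simp [lastRatio, greedyStep]
  rw [e, lastRatio]
  constructor
  · gcongr
  · intro h
    have p3 := maxNext_pos (ha.mono (by omega : n + 1 ≤ n + 2))
    field_simp at h
    linarith

theorem lastRatio_greedyExt_succ {a : ℕ → ℝ} {n m k : ℕ} (ha : Valid a (k + 2))
    (hkm : k + 2 + m = n + 2) (hm : 1 ≤ m) :
    lastRatio n (greedyExt (m + 1) k a) ≤ lastRatio n (greedyExt m (k + 1) a) ∧
      (lastRatio n (greedyExt (m + 1) k a) = lastRatio n (greedyExt m (k + 1) a) →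
        a (k + 2) = maxNext a k) := by
  have hle := ha.le_maxNext
  have ha1 : Valid a (k + 1) := ha.mono (by omega)
  set M := maxNext a k with hM
  let I := Set.Icc (a (k + 2)) M
  let c : I → ℕ → ℝ := fun t => Function.update a (k + 2) (t : ℝ)
  have hc : ∀ i, Continuous fun t => c t i := by
    intro i
    rcases eq_or_ne i (k + 2) with rfl | hi
    · simpa [c] using continuous_subtype_val
    · simpa [c, hi] using continuous_const
  have hv : ∀ t, Valid (c t) (k + 2) := fun t =>
    valid_update ha1 ((ha.pos _ le_rfl).trans_le t.2.1) t.2.2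
  let e : I → ℕ → ℝ := fun t => greedyExt m (k + 1) (c t)
  have he : ∀ i, Continuous fun t => e t i := continuous_greedyExt m hc hv
  have hev : ∀ t, Valid (e t) (n + 2) := fun t => by
    have := greedyExt_valid m (hv t)
    rwa [show k + 1 + 1 + m = n + 2 by omega] at this
  have heg : ∀ t l, k + 1 < l → l < n + 2 → Greedy (e t) l := fun t l h1 h2 =>
    greedyExt_greedy m (hv t) h1 (by omega)
  have hpos : ∀ t i, i ≤ n + 2 → e t i ≠ 0 := fun t i hi => ((hev t).pos i hi).ne'
  have hQ : Continuous fun t => lastRatio n (e t) :=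
    ((he (n + 1)).pow 2).div ((he n).mul (he (n + 2))) fun t =>
      mul_ne_zero (hpos t _ (by omega)) (hpos t _ le_rfl)
  -- a minimizer is the right endpoint
  have key : ∀ t : I, (∀ u : I, lastRatio n (e t) ≤ lastRatio n (e u)) → (t : ℝ) = M := by
    intro t hmin
    by_contra hne
    have htM : (t : ℝ) < M := lt_of_le_of_ne t.2.2 hne
    obtain ⟨ε, hε, H⟩ := exists_lt_of_quotDiff_lt (hev t) (j := k + 1) (by omega) (by omega)
      (heg t)
    have hcont : Continuous fun u : I => quotDiff (e t) (e u) (n + 1) :=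
      ((he (n + 1)).div_const _).sub ((he n).div_const _)
    have h0 : quotDiff (e t) (e t) (n + 1) = 0 := by
      simp only [quotDiff, quot]
      rw [div_self (hpos t _ (by omega)), div_self (hpos t _ (by omega)), sub_self]
    have hev1 : ∀ᶠ u in nhds t, quotDiff (e t) (e u) (n + 1) < ε :=
      hcont.continuousAt.eventually_lt_const (h0.trans_lt hε)
    obtain ⟨δ, hδ, hball⟩ := Metric.eventually_nhds_iff.1 hev1
    have htu : (t : ℝ) < min (t + δ / 2) M := lt_min (by linarith) htM
    let u : I := ⟨min (t + δ / 2) M, t.2.1.trans htu.le, min_le_right _ _⟩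
    have hdist : dist u t < δ := by
      rw [Subtype.dist_eq, Real.dist_eq, abs_of_pos (sub_pos.2 htu)]
      have := min_le_left ((t : ℝ) + δ / 2) M
      linarith
    have hagree : ∀ v : I, ∀ i ≤ k + 2, e v i = c v i := fun v i hi =>
      greedyExt_of_le m _ hi
    refine absurd (H (e u) (hev u) ?_ ?_ (heg u) (hball hdist)) (hmin u).not_gt
    · intro i hi
      rw [hagree u i (by omega), hagree t i (by omega)]
      simp only [c]
      rw [Function.update_of_ne (by omega), Function.update_of_ne (by omega)]
    · rw [hagree u _ le_rfl, hagree t _ le_rfl]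
      simp only [c, Function.update_self]
      exact htu
  have hne : (Set.univ : Set I).Nonempty := ⟨⟨a (k + 2), le_rfl, hle⟩, trivial⟩
  have : CompactSpace I := isCompact_iff_compactSpace.1 isCompact_Icc
  obtain ⟨t₀, -, hmin⟩ := isCompact_univ.exists_isMinOn hne hQ.continuousOn
  have hmin' : ∀ u : I, lastRatio n (e t₀) ≤ lastRatio n (e u) := fun u => hmin (Set.mem_univ u)
  have hM0 := key t₀ hmin'
  have e1 : e t₀ = greedyExt (m + 1) k a := by
    simp only [e, c, greedyExt, greedyStep]
    rw [hM0]
  have e2 : e ⟨a (k + 2), le_rfl, hle⟩ = greedyExt m (k + 1) a := by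
    simp only [e, c, Function.update_eq_self]
  rw [← e1, ← e2]
  refine ⟨hmin' _, fun heq => key ⟨a (k + 2), le_rfl, hle⟩ fun u => ?_⟩
  rw [← heq]
  exact hmin' u

theorem lastRatio_greedyExt {a : ℕ → ℝ} {n : ℕ} (ha : Valid a (n + 2)) (m k : ℕ)
    (hkm : k + 1 + m = n + 2) :
    lastRatio n (greedyExt m k a) ≤ lastRatio n a ∧
      (lastRatio n (greedyExt m k a) = lastRatio n a →
        ∀ i, k ≤ i → i ≤ n → a (i + 2) = maxNext a i) := by
  induction m generalizing k with
  | zero => exact ⟨le_rfl, fun _ i h1 h2 => by omega⟩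
  | succ m ih =>
    obtain ⟨i1, i2⟩ := ih (k + 1) (by omega)
    have hstep : lastRatio n (greedyExt (m + 1) k a) ≤ lastRatio n (greedyExt m (k + 1) a) ∧
        (lastRatio n (greedyExt (m + 1) k a) = lastRatio n (greedyExt m (k + 1) a) →
          a (k + 2) = maxNext a k) := by
      rcases Nat.eq_zero_or_pos m with rfl | hm
      · obtain rfl : k = n := by omega
        exact lastRatio_greedyStep ha
      · exact lastRatio_greedyExt_succ (ha.mono (by omega)) (by omega) hm
    refine ⟨hstep.1.trans i1, fun heq i h1 h2 => ?_⟩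
    rcases Nat.lt_or_eq_of_le h1 with h | rfl
    · exact i2 (le_antisymm i1 (by rw [← heq]; exact hstep.1)) i h h2
    · exact hstep.2 (le_antisymm hstep.1 (by rw [heq]; exact i1))

theorem rev_scale (a : ℕ → ℝ) (r : ℝ) (k : ℕ) (y : ℝ) :
    rev (fun i => a i * r ^ i) k (r * y) = r ^ k * rev a k y := by
  induction k with
  | zero => simp [rev]
  | succ k ih =>
    simp only [rev]
    rw [ih]
    ring

theorem maxNext_scale (a : ℕ → ℝ) {r : ℝ} (hr : 0 < r) (k : ℕ) :
    maxNext (fun i => a i * r ^ i) k = maxNext a k * r ^ (k + 2) := by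
  have h : ∀ s, s * (a (k + 1) * r ^ (k + 1) / (a k * r ^ k)) *
      rev (fun i => a i * r ^ i) (k + 1) (s * (a (k + 1) * r ^ (k + 1) / (a k * r ^ k))) =
      r ^ (k + 2) * (s * (a (k + 1) / a k) * rev a (k + 1) (s * (a (k + 1) / a k))) := by
    intro s
    have e : s * (a (k + 1) * r ^ (k + 1) / (a k * r ^ k)) = r * (s * (a (k + 1) / a k)) := by
      rw [pow_succ]
      field_simp
    rw [e, rev_scale]
    ring
  simp only [maxNext, h]
  rw [mul_comm, ← smul_eq_mul, ← Real.sSup_smul_of_nonneg (by positivity : 0 ≤ r ^ (k + 2))]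
  congr 1
  rw [← Set.image_smul, Set.image_image]
  rfl

theorem sum_attach_eq_sect (c : ℕ → ℝ) (k : ℕ) (t : ℝ) :
    (∑ j ∈ (Finset.range (k + 2)).attach, C (c j.1) * X ^ (j.1 : ℕ)) + C t * X ^ (k + 2) =
      sect (Function.update c (k + 2) t) (k + 2) := by
  rw [sect, Finset.sum_range_succ, Function.update_self,
    Finset.sum_attach (Finset.range (k + 2)) fun j => C (c j) * X ^ j]
  congr 1
  apply Finset.sum_congr rfl
  intro j hj
  rw [Finset.mem_range] at hj
  rw [Function.update_of_ne (by omega)]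

theorem isGreatest_maxNext {a : ℕ → ℝ} {k : ℕ} (ha : Valid a (k + 1)) :
    IsGreatest {t : ℝ | 0 < t ∧ Hyperbolic (sect (Function.update a (k + 2) t) (k + 2))}
      (maxNext a k) := by
  constructor
  · have h := valid_update ha (maxNext_pos ha) le_rfl
    exact ⟨maxNext_pos ha, (h.real _ le_rfl).hyperbolic h.zero⟩
  · rintro t ⟨ht0, ht⟩
    have hag : ∀ i ≤ k + 1, a i = Function.update a (k + 2) t i := fun i hi => by
      rw [Function.update_of_ne (by omega)]
    have hv := ha.congr hag
    have hpos : ∀ i ≤ k + 2, 0 < Function.update a (k + 2) t i := by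
      intro i hi
      rcases Nat.lt_or_eq_of_le hi with h | rfl
      · exact hv.pos i (by omega)
      · simpa using ht0
    have hval : Valid (Function.update a (k + 2) t) (k + 2) := by
      refine ⟨hv.zero, hpos, fun i hi => ?_⟩
      rcases Nat.lt_or_eq_of_le hi with h | rfl
      · exact hv.real i (by omega)
      · exact RealRooted.of_hyperbolic hv.zero hpos ht
    have := hval.le_maxNext
    rwa [Function.update_self, ← maxNext_congr hag] at this

theorem realRooted_zero {a : ℕ → ℝ} (h0 : a 0 = 1) : RealRooted a 0 :=
  ⟨0, by simp, by simp, fun y => by simp [rev, rootProd, h0]⟩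

theorem realRooted_one {a : ℕ → ℝ} (h0 : a 0 = 1) (h1 : 0 < a 1) : RealRooted a 1 :=
  ⟨{a 1}, by simp, by simpa using h1, fun y => by simp [rev, rootProd, h0]⟩

theorem Acoef_zero : Acoef 0 = 1 := by
  rw [Acoef]

theorem Acoef_one : Acoef 1 = 1 := by
  rw [Acoef]

theorem Acoef_add_two (k : ℕ) (h : Valid Acoef (k + 1)) : Acoef (k + 2) = maxNext Acoef k := by
  rw [Acoef]
  simp only [sum_attach_eq_sect]
  exact (isGreatest_maxNext h).csSup_eq

theorem valid_Acoef (k : ℕ) : Valid Acoef (k + 1) := by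
  induction k with
  | zero =>
    have h1 : 0 < Acoef 1 := by rw [Acoef_one]; exact one_pos
    refine ⟨Acoef_zero, fun i hi => ?_, fun i hi => ?_⟩
    · interval_cases i
      · rw [Acoef_zero]; exact one_pos
      · exact h1
    · interval_cases i
      · exact realRooted_zero Acoef_zero
      · exact realRooted_one Acoef_zero h1
  | succ k ih =>
    have := valid_update ih (maxNext_pos ih) le_rfl
    rwa [← Acoef_add_two k ih, Function.update_eq_self] at this

/-- A greedy coefficient sequence is a rescaling of the extremal one. -/
theorem eq_Acoef_mul_pow {a : ℕ → ℝ} {n : ℕ} (h0 : a 0 = 1) (h1 : 0 < a 1)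
    (h : ∀ i ≤ n, a (i + 2) = maxNext a i) : ∀ j ≤ n + 2, a j = Acoef j * a 1 ^ j := by
  intro j
  induction j using Nat.strong_induction_on with
  | _ j ih =>
    intro hj
    match j with
    | 0 => simp [h0, Acoef_zero]
    | 1 => simp [Acoef_one]
    | i + 2 =>
      rw [h i (by omega), Acoef_add_two i (valid_Acoef i), ← maxNext_scale Acoef h1]
      exact maxNext_congr fun l hl => ih l (by omega) (by omega)

theorem lastRatio_eq_of_greedy {a : ℕ → ℝ} {n : ℕ} (h0 : a 0 = 1) (h1 : 0 < a 1)
    (h : ∀ i ≤ n, a (i + 2) = maxNext a i) : lastRatio n a = lastRatio n Acoef := by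
  have e := eq_Acoef_mul_pow h0 h1 h
  simp only [lastRatio]
  rw [e n (by omega), e (n + 1) (by omega), e (n + 2) le_rfl]
  have p0 := (valid_Acoef (n + 1)).pos n (by omega)
  have p2 := (valid_Acoef (n + 1)).pos (n + 2) le_rfl
  rw [div_eq_div_iff (by positivity) (by positivity)]
  ring

theorem SectionHyperbolic.valid {a : ℕ → ℝ} {n : ℕ} (h : SectionHyperbolic a n) (h0 : a 0 = 1) :
    Valid a n := by
  refine ⟨h0, h.1, fun i hi => ?_⟩
  rcases Nat.eq_zero_or_pos i with rfl | hi0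
  · exact realRooted_zero h0
  · exact RealRooted.of_hyperbolic h0 (fun l hl => h.1 l (hl.trans hi)) (h.2 i hi0 hi)

/-- Uniqueness of the minimizer: a section-hyperbolic polynomial of degree `i+1` with constant
term `1` for which `a_i^2/(a_{i-1} a_{i+1}) = A_i^2/(A_{i-1} A_{i+1})` coincides with
`p_{i+1}(c x)` for some `c > 0`, i.e. `a_j = A_j c^j` for all `j ≤ i+1`. -/
theorem stmt4 (i : ℕ) (hi : 1 ≤ i) (a : ℕ → ℝ) (h : SectionHyperbolic a (i + 1))
    (h0 : a 0 = 1)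
    (heq : a i ^ 2 / (a (i - 1) * a (i + 1)) = Acoef i ^ 2 / (Acoef (i - 1) * Acoef (i + 1))) :
    ∃ c : ℝ, 0 < c ∧ ∀ j ≤ i + 1, a j = Acoef j * c ^ j := by
  obtain ⟨n, rfl⟩ : ∃ n, i = n + 1 := ⟨i - 1, by omega⟩
  have ha : Valid a (n + 2) := h.valid h0
  have h1 : 0 < a 1 := ha.pos 1 (by omega)
  have hv : Valid a (0 + 1) := ha.mono (by omega)
  have e0 : greedyExt (n + 1) 0 a 0 = a 0 := greedyExt_of_le _ _ (by omega)
  have e1 : greedyExt (n + 1) 0 a 1 = a 1 := greedyExt_of_le _ _ (by omega)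
  have hratio : lastRatio n (greedyExt (n + 1) 0 a) = lastRatio n a := by
    rw [lastRatio_eq_of_greedy (by rw [e0, h0]) (by rwa [e1]) fun i hi =>
      greedyExt_eq_maxNext (n + 1) a (Nat.zero_le i) (by omega)]
    exact heq.symm
  have hg := (lastRatio_greedyExt ha (n + 1) 0 (by omega)).2 hratio
  exact ⟨a 1, h1, eq_Acoef_mul_pow h0 h1 fun i hi => hg i (Nat.zero_le i) hi⟩
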